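/- arXiv:2305.03168 — 4 statements merged into one kernel-verified Lean document; each statement's English description precedes it below -/
import Mathlib

section
/- Let q = 2^n with n odd and n ≥ 7. Then t⁻(q) := q − 2^{(n+1)/2} + 1 is divisible by a primitive prime divisor of 2^{4n} − 1, i.e. by a prime ℓ dividing 2^{4n} − 1 such that ℓ does not divide 2^i − 1 for any 1 ≤ i < 4n. -/
open Polynomial

/-- If a prime `p ∣ n` divides a value of the `n`-th cyclotomic polynomial, then it is the largest
prime factor of `n`. -/
lemma prime_le_of_dvd_eval_cyclotomic {n p r : ℕ} (hn : n ≠ 0) (hp : p.Prime) (hr : r.Prime)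
    (hrn : r ∣ n) {x : ℤ} (hx : (p : ℤ) ∣ (cyclotomic n ℤ).eval x) : r ≤ p := by
  have := Fact.mk hp
  obtain ⟨e, m, hpm, rfl⟩ := Nat.exists_eq_pow_mul_and_not_dvd hn p hp.ne_one
  have hm : m ≠ 0 := right_ne_zero_of_mul hn
  have : NeZero (m : ZMod p) := ⟨by rwa [Ne, ZMod.natCast_eq_zero_iff]⟩
  have hroot : (cyclotomic (p ^ e * m) (ZMod p)).IsRoot (x : ZMod p) := by
    rw [← ZMod.intCast_zmod_eq_zero_iff_dvd] at hx
    have := cyclotomic.eval_apply x (p ^ e * m) (Int.castRingHom (ZMod p))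
    simpa [IsRoot, hx] using this
  have hprim := isRoot_cyclotomic_prime_pow_mul_iff_of_charP.mp hroot
  have hdvd : m ∣ p - 1 := by
    rw [hprim.eq_orderOf]
    exact ZMod.orderOf_dvd_card_sub_one (hprim.ne_zero hm)
  rcases hr.dvd_mul.mp hrn with h | h
  · exact Nat.le_of_dvd hp.pos (hr.dvd_of_dvd_pow h)
  · have := Nat.le_of_dvd (Nat.sub_pos_of_lt hp.one_lt) (h.trans hdvd)
    omega

/-- An odd prime factor of `n` divides values of the `n`-th cyclotomic polynomial at most once. -/
lemma not_sq_dvd_eval_cyclotomic {n p : ℕ} (hn : n ≠ 0) (hp : p.Prime) (hodd : Odd p)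
    (hpn : p ∣ n) (x : ℤ) : ¬ (p : ℤ) ^ 2 ∣ (cyclotomic n ℤ).eval x := by
  intro h
  have := Fact.mk hp
  obtain ⟨d, rfl⟩ := hpn
  have hd : d ≠ 0 := right_ne_zero_of_mul hn
  have hdn : d ∈ (p * d).properDivisors := by
    rw [Nat.mem_properDivisors]
    exact ⟨dvd_mul_left _ _, lt_mul_of_one_lt_left (Nat.pos_of_ne_zero hd) hp.one_lt⟩
  have hgeom : cyclotomic (p * d) ℤ ∣ ∑ i ∈ Finset.range p, (X ^ d) ^ i := by
    have h1 := X_pow_sub_one_mul_cyclotomic_dvd_X_pow_sub_one_of_dvd ℤ hdn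
    have h2 : (X : ℤ[X]) ^ (p * d) - 1 = (X ^ d - 1) * ∑ i ∈ Finset.range p, (X ^ d) ^ i := by
      rw [mul_geom_sum, ← pow_mul, mul_comm]
    rw [h2] at h1
    exact (mul_dvd_mul_iff_left (monic_X_pow_sub_C (1 : ℤ) hd).ne_zero).mp (by simpa using h1)
  have hsum : (p : ℤ) ^ 2 ∣ ∑ i ∈ Finset.range p, (x ^ d) ^ i := by
    refine h.trans ?_
    simpa [eval_finsetSum] using eval_dvd (x := x) hgeom
  have hone : (p : ℤ) ∣ x ^ d - 1 := by
    have h1 : (p : ℤ) ∣ (x ^ d) ^ p - 1 := by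
      rw [← mul_geom_sum]
      exact (dvd_of_mul_left_dvd (by simpa [sq] using hsum)).mul_left _
    rw [← ZMod.intCast_zmod_eq_zero_iff_dvd] at h1 ⊢
    push_cast at h1 ⊢
    rwa [ZMod.pow_card] at h1
  obtain ⟨b, hb⟩ := hone
  have h3 := odd_sq_dvd_geom_sum₂_sub (1 : ℤ) b hodd
  rw [← hb] at h3
  simp only [add_sub_cancel, one_pow, mul_one] at h3
  have h4 := (dvd_sub_right hsum).mp h3
  have h5 : p ^ 2 ∣ p := by exact_mod_cast h4
  have h6 := Nat.le_of_dvd hp.pos h5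
  nlinarith [hp.one_lt]

lemma cyclotomic_prime_pow_mul_eval {R : Type*} [CommRing R] {p m : ℕ} (hp : p.Prime)
    (hpm : ¬ p ∣ m) (k : ℕ) (w : R) :
    (cyclotomic (p ^ (k + 1) * m) R).eval w * (cyclotomic m R).eval (w ^ p ^ k) =
      (cyclotomic m R).eval (w ^ p ^ (k + 1)) := by
  induction k generalizing w with
  | zero =>
    have h := congrArg (eval w) (cyclotomic_expand_eq_cyclotomic_mul hp hpm R)
    rw [expand_eval, eval_mul] at h
    simpa [mul_comm] using h.symm
  | succ k ih =>
    have hdvd : p ∣ p ^ (k + 1) * m := (dvd_pow_self p k.succ_ne_zero).mul_right m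
    have h := congrArg (eval w) (cyclotomic_expand_eq_cyclotomic hp hdvd R)
    rw [expand_eval] at h
    have h2 : p ^ (k + 1 + 1) * m = p ^ (k + 1) * m * p := by ring
    rw [h2, ← h, pow_succ' p k, pow_succ' p (k + 1), pow_mul, pow_mul, ← pow_succ' p k]
    exact ih (w ^ p)

lemma norm_eval_cyclotomic_eq_prod {m : ℕ} (hm : m ≠ 0) (z : ℂ) :
    ‖(cyclotomic m ℂ).eval z‖ = ∏ μ ∈ primitiveRoots m ℂ, ‖z - μ‖ := by
  rw [cyclotomic_eq_prod_X_sub_primitiveRoots (Complex.isPrimitiveRoot_exp m hm), eval_prod,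
    norm_prod]
  simp

lemma norm_sub_one_pow_totient_le {m : ℕ} (hm : m ≠ 0) {z : ℂ} (hz : 1 ≤ ‖z‖) :
    (‖z‖ - 1) ^ m.totient ≤ ‖(cyclotomic m ℂ).eval z‖ := by
  rw [norm_eval_cyclotomic_eq_prod hm, ← Complex.card_primitiveRoots, ← Finset.prod_const]
  refine Finset.prod_le_prod (fun _ _ => sub_nonneg.mpr hz) fun μ hμ => ?_
  have h := ((mem_primitiveRoots (Nat.pos_of_ne_zero hm)).mp hμ).norm'_eq_one hm
  simpa [h] using norm_sub_norm_le z μ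

lemma norm_eval_cyclotomic_le {m : ℕ} (hm : m ≠ 0) (z : ℂ) :
    ‖(cyclotomic m ℂ).eval z‖ ≤ (‖z‖ + 1) ^ m.totient := by
  rw [norm_eval_cyclotomic_eq_prod hm, ← Complex.card_primitiveRoots, ← Finset.prod_const]
  refine Finset.prod_le_prod (fun _ _ => norm_nonneg _) fun μ hμ => ?_
  have h := ((mem_primitiveRoots (Nat.pos_of_ne_zero hm)).mp hμ).norm'_eq_one hm
  simpa [h] using norm_sub_le z μ

lemma pow_totient_le_norm_eval_cyclotomic {p m k : ℕ} (hp : p.Prime) (hpm : ¬ p ∣ m)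
    (hm : m ≠ 0) {w : ℂ} (hw : 1 < ‖w‖) {c : ℝ} (hc : 0 ≤ c)
    (hcw : c * (‖w‖ ^ p ^ k + 1) ≤ (‖w‖ ^ p ^ k) ^ p - 1) :
    c ^ m.totient ≤ ‖(cyclotomic (p ^ (k + 1) * m) ℂ).eval w‖ := by
  have h1 := congrArg norm (cyclotomic_prime_pow_mul_eval hp hpm k w)
  rw [norm_mul] at h1
  have h2 := norm_sub_one_pow_totient_le hm (z := w ^ p ^ (k + 1))
    (by rw [norm_pow]; exact one_le_pow₀ hw.le)
  have h3 := norm_eval_cyclotomic_le hm (w ^ p ^ k)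
  rw [norm_pow] at h2 h3
  rw [pow_succ p k, pow_mul] at h2
  have hpos : 0 < (‖w‖ ^ p ^ k + 1) ^ m.totient := by positivity
  refine le_of_mul_le_mul_right ?_ hpos
  calc c ^ m.totient * (‖w‖ ^ p ^ k + 1) ^ m.totient
      = (c * (‖w‖ ^ p ^ k + 1)) ^ m.totient := (mul_pow _ _ _).symm
    _ ≤ ((‖w‖ ^ p ^ k) ^ p - 1) ^ m.totient := by gcongr
    _ ≤ ‖(cyclotomic (p ^ (k + 1) * m) ℂ).eval w‖ * ‖(cyclotomic m ℂ).eval (w ^ p ^ k)‖ :=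
        h2.trans h1.ge
    _ ≤ _ := by gcongr

lemma lt_two_pow_sub_three {p : ℕ} (hp : 7 ≤ p) : p < 2 ^ (p - 3) := by
  induction p, hp using Nat.le_induction with
  | base => norm_num
  | succ p hp ih =>
    rw [show p + 1 - 3 = p - 3 + 1 by omega, pow_succ]
    omega

/-- At a point of absolute value `√2`, the `n`-th cyclotomic polynomial is large compared with the
largest prime factor of `n`. -/
lemma lt_normSq_eval_cyclotomic {n p : ℕ} (hodd : Odd n) (hn : 7 ≤ n) (hp : p.Prime)
    (hpn : p ∣ n) (hmax : ∀ r : ℕ, r.Prime → r ∣ n → r ≤ p) {w : ℂ} (hw : ‖w‖ ^ 2 = 2) :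
    (p : ℝ) < ‖(cyclotomic n ℂ).eval w‖ ^ 2 := by
  obtain ⟨e, m, hpm, rfl⟩ := Nat.exists_eq_pow_mul_and_not_dvd (by omega : n ≠ 0) p hp.ne_one
  obtain ⟨k, rfl⟩ : ∃ k, e = k + 1 := by
    refine Nat.exists_eq_succ_of_ne_zero ?_
    rintro rfl
    simp [hpm] at hpn
  have hm : m ≠ 0 := by rintro rfl; simp at hpm
  have hoddp : Odd p := hodd.of_dvd_nat hpn
  have hoddm : Odd m := hodd.of_dvd_nat (dvd_mul_left _ _)
  have hw1 : 7 / 5 ≤ ‖w‖ := by nlinarith [norm_nonneg w]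
  have hw0 : 1 ≤ ‖w‖ := by linarith
  set s := ‖w‖
  set r := s ^ p ^ k
  have hsr : s ≤ r := le_self_pow₀ hw0 (pow_ne_zero _ hp.ne_zero)
  have hr1 : 7 / 5 ≤ r := hw1.trans hsr
  have key : ∀ c : ℝ, 0 ≤ c → c * (r + 1) ≤ r ^ p - 1 →
      (c ^ m.totient) ^ 2 ≤ ‖(cyclotomic (p ^ (k + 1) * m) ℂ).eval w‖ ^ 2 := fun c hc h =>
    pow_le_pow_left₀ (by positivity)
      (pow_totient_le_norm_eval_cyclotomic hp hpm hm (by linarith) hc h) 2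
  have hφ : m.totient ≠ 0 := (Nat.totient_pos.mpr (Nat.pos_of_ne_zero hm)).ne'
  have key_one : ∀ c : ℝ, 1 ≤ c → c * (r + 1) ≤ r ^ p - 1 → (p : ℝ) < c ^ 2 →
      (p : ℝ) < ‖(cyclotomic (p ^ (k + 1) * m) ℂ).eval w‖ ^ 2 := fun c hc h hpc =>
    hpc.trans_le <| (pow_le_pow_left₀ (by positivity) (le_self_pow₀ hc hφ) 2).trans
      (key c (by positivity) h)
  have hpow : ∀ a : ℕ, p ^ a ≤ p ^ k → s ^ p ^ a ≤ r := fun a ha => pow_le_pow_right₀ hw0 ha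
  have hk_of_one : m = 1 → p ≤ 5 → p ^ 1 ≤ p ^ k := by
    rintro rfl hp5
    refine Nat.pow_le_pow_right hp.pos (Nat.pos_of_ne_zero ?_)
    rintro rfl
    simp at hn
    omega
  obtain hp7 | hp7 := le_or_gt 7 p
  · have hH : (s ^ (p - 1)) ^ 2 = 4 * 2 ^ (p - 3) := by
      rw [← pow_mul, mul_comm, pow_mul, hw, show p - 1 = p - 3 + 2 by omega, pow_add]
      ring
    have hlt : (p : ℝ) < 2 ^ (p - 3) := by exact_mod_cast lt_two_pow_sub_three hp7
    have hp7' : (7 : ℝ) ≤ p := by exact_mod_cast hp7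
    have hH0 : 0 ≤ s ^ (p - 1) := by positivity
    have hH5 : 5 ≤ s ^ (p - 1) := by nlinarith
    refine key_one (s ^ (p - 1) / 2) (by linarith) ?_ (by nlinarith)
    have hrp : r * s ^ (p - 1) ≤ r ^ p := by
      conv_rhs => rw [show p = p - 1 + 1 by omega, pow_succ']
      gcongr
    nlinarith
  · have h357 : p = 3 ∨ p = 5 := by
      interval_cases p <;> simp_all +decide
    rcases h357 with rfl | rfl
    · have hm1 : m = 1 := by
        by_contra h1
        have hq := Nat.minFac_prime h1
        have hle := hmax _ hq ((Nat.minFac_dvd m).mul_left _)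
        have hq2 := hq.two_le
        have hqo : Odd m.minFac := hoddm.of_dvd_nat (Nat.minFac_dvd m)
        have hq3 : m.minFac = 3 := by
          obtain ⟨j, hj⟩ := hqo
          omega
        exact hpm (hq3 ▸ Nat.minFac_dvd m)
      have hr3 := hpow 1 (hk_of_one hm1 (by norm_num))
      have hr28 : 14 / 5 ≤ r := by nlinarith [show s ^ 3 ^ 1 = s ^ 2 * s by ring]
      refine key_one 2 (by norm_num) ?_ (by norm_num)
      nlinarith [mul_nonneg (sub_nonneg.mpr hr28) (sub_nonneg.mpr hr28)]
    · have hs4 : s ^ 4 = 4 := by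
        rw [show s ^ 4 = (s ^ 2) ^ 2 by ring, hw]; norm_num
      have hr4 : 4 ≤ r ^ 4 := hs4 ▸ pow_le_pow_left₀ (by positivity) hsr 4
      have hr5 : r * 4 ≤ r ^ 5 := by
        rw [pow_succ']; gcongr
      by_cases hm1 : m = 1
      · have h5 := hpow 1 (hk_of_one hm1 le_rfl)
        have hr56 : 28 / 5 ≤ r := by nlinarith [show s ^ 5 ^ 1 = s ^ 4 * s by ring]
        exact key_one 3 (by norm_num) (by linarith) (by norm_num)
      · have hm2 : 2 < m := by
          obtain ⟨j, hj⟩ := hoddm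
          omega
        have hφ2 : 2 ≤ m.totient := by
          obtain ⟨j, hj⟩ := Nat.totient_even hm2
          omega
        refine lt_of_lt_of_le ?_ (key (19 / 10) (by norm_num) (by linarith))
        calc ((5 : ℕ) : ℝ) < (((19 : ℝ) / 10) ^ 2) ^ 2 := by norm_num
          _ ≤ _ := by gcongr; norm_num

/-- The Aurifeuillian factor `2 ^ n - 2 ^ ((n + 1) / 2) + 1` is the norm of `1 - w ^ n`, where `w`
is one of the Gaussian integers `1 + i` and `-(1 + i)`. -/
lemma exists_norm_one_sub_pow_eq {n : ℕ} (hodd : Odd n) :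
    ∃ ε : ℤ, (ε = 1 ∨ ε = -1) ∧
      Zsqrtd.norm (1 - (⟨ε, ε⟩ : GaussianInt) ^ n) = 2 ^ n - 2 ^ ((n + 1) / 2) + 1 := by
  have hpow : ∀ (ε : ℤ), (ε = 1 ∨ ε = -1) → ∀ k r : ℕ,
      (⟨ε, ε⟩ : GaussianInt) ^ (8 * k + r) =
        (((2 : ℤ) ^ (4 * k) : ℤ) : GaussianInt) * ⟨ε, ε⟩ ^ r := by
    intro ε hε k r
    have h8 : (⟨ε, ε⟩ : GaussianInt) ^ 8 = ((2 ^ 4 : ℤ) : GaussianInt) := by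
      rcases hε with rfl | rfl <;> decide
    rw [pow_add, pow_mul, h8, pow_mul]
    push_cast
    rfl
  obtain ⟨k, r, rfl, hr⟩ : ∃ k r, n = 8 * k + r ∧ (r = 1 ∨ r = 3 ∨ r = 5 ∨ r = 7) := by
    refine ⟨n / 8, n % 8, (Nat.div_add_mod n 8).symm, ?_⟩
    obtain ⟨j, hj⟩ := hodd
    omega
  have main : ∀ (ε a b : ℤ), (ε = 1 ∨ ε = -1) → (⟨ε, ε⟩ : GaussianInt) ^ r = ⟨a, b⟩ →
      2 * a = 2 ^ ((r + 1) / 2) → a ^ 2 + b ^ 2 = 2 ^ r →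
      Zsqrtd.norm (1 - (⟨ε, ε⟩ : GaussianInt) ^ (8 * k + r)) =
        2 ^ (8 * k + r) - 2 ^ ((8 * k + r + 1) / 2) + 1 := by
    intro ε a b hε hab ha hb
    rw [hpow ε hε, hab, show (8 * k + r + 1) / 2 = 4 * k + (r + 1) / 2 by omega, pow_add, pow_add,
      ← ha, ← hb, show 8 * k = 4 * k + 4 * k by ring, pow_add]
    simp only [Zsqrtd.norm_def, Zsqrtd.smul_val, Zsqrtd.re_sub, Zsqrtd.im_sub, Zsqrtd.re_one,
      Zsqrtd.im_one]
    ring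
  rcases hr with rfl | rfl | rfl | rfl
  · exact ⟨1, .inl rfl, main 1 1 1 (.inl rfl) (by decide) (by norm_num) (by norm_num)⟩
  · exact ⟨-1, .inr rfl, main (-1) 2 (-2) (.inr rfl) (by decide) (by norm_num) (by norm_num)⟩
  · exact ⟨-1, .inr rfl, main (-1) 4 4 (.inr rfl) (by decide) (by norm_num) (by norm_num)⟩
  · exact ⟨1, .inl rfl, main 1 8 (-8) (.inl rfl) (by decide) (by norm_num) (by norm_num)⟩

/-- Modulo a divisor of `a ^ 2 + 1`, the norm of `Φₙ(ε + ε i)` factors as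
`Φₙ(ε (1 + a)) Φₙ(ε (1 - a))`. -/
lemma dvd_eval_cyclotomic_mul_of_dvd_norm {M n : ℕ} {a ε : ℤ} (ha : (M : ℤ) ∣ a ^ 2 + 1)
    (hM : (M : ℤ) ∣ Zsqrtd.norm ((cyclotomic n GaussianInt).eval ⟨ε, ε⟩)) :
    (M : ℤ) ∣ (cyclotomic n ℤ).eval (ε * (1 + a)) * (cyclotomic n ℤ).eval (ε * (1 - a)) := by
  rw [← ZMod.intCast_zmod_eq_zero_iff_dvd] at ha hM ⊢
  push_cast at ha
  let f : GaussianInt →+* ZMod M := Zsqrtd.lift ⟨(a : ZMod M), by push_cast; linear_combination ha⟩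
  have hf : ∀ x y : ℤ, f ⟨x, y⟩ = x + y * a := fun x y => rfl
  have hnorm := congrArg f (Zsqrtd.norm_eq_mul_conj ((cyclotomic n GaussianInt).eval ⟨ε, ε⟩))
  have hstar : star ((cyclotomic n GaussianInt).eval ⟨ε, ε⟩) =
      (cyclotomic n GaussianInt).eval ⟨ε, -ε⟩ :=
    (cyclotomic.eval_apply _ n (starRingEnd GaussianInt)).symm
  rw [hstar, map_mul, map_intCast, hM, ← cyclotomic.eval_apply, ← cyclotomic.eval_apply, hf, hf]
    at hnorm
  have hcast := fun x : ℤ => cyclotomic.eval_apply x n (Int.castRingHom (ZMod M))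
  simp only [eq_intCast] at hcast
  rw [Int.cast_mul, ← hcast, ← hcast, hnorm]
  congr 2 <;> push_cast <;> ring

/-- If `x` is a primitive `n`-th root of unity with `x ^ 8 = 2 ^ 4` and `2 ^ n` is a square root of
`-1`, then `2` has order `4 * n`. -/
lemma four_mul_dvd_of_two_pow_eq_one {K : Type*} [Field K] {n j : ℕ} (hodd : Odd n)
    (h2 : (2 : K) ≠ 0) {x : K} (hx : IsPrimitiveRoot x n) (hx8 : x ^ 8 = 2 ^ 4)
    (hsq : ((2 : K) ^ n) ^ 2 = -1) (hj : (2 : K) ^ j = 1) : 4 * n ∣ j := by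
  have hnj : n ∣ 8 * j := hx.dvd_of_pow_eq_one _ <| by
    rw [pow_mul, hx8, ← pow_mul, mul_comm, pow_mul, hj, one_pow]
  have hcop : n.Coprime 8 := (Nat.coprime_two_right.mpr hodd).pow_right 3
  obtain ⟨s, rfl⟩ := hcop.dvd_of_dvd_mul_left hnj
  have hne : (-1 : K) ≠ 1 := fun h => h2 (by linear_combination -h)
  have hord : orderOf ((2 : K) ^ n) = 2 ^ (1 + 1) := by
    have := Fact.mk Nat.prime_two
    refine orderOf_eq_prime_pow ?_ ?_
    · rwa [pow_one, hsq]
    · rw [show 2 ^ (1 + 1) = 2 * 2 by norm_num, pow_mul, hsq]; norm_num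
  rw [pow_mul] at hj
  have h4 := orderOf_dvd_of_pow_eq_one hj
  rw [hord] at h4
  rw [mul_comm 4]
  exact mul_dvd_mul_left n (by simpa using h4)

theorem ppd_divides_t_minus (n : ℕ) (hodd : Odd n) (hn : 7 ≤ n) :
    ∃ ℓ : ℕ, ℓ.Prime ∧ (ℓ : ℤ) ∣ 2 ^ (4 * n) - 1 ∧
      (∀ i : ℕ, 1 ≤ i → i < 4 * n → ¬ (ℓ : ℤ) ∣ 2 ^ i - 1) ∧
      (ℓ : ℤ) ∣ (2 : ℤ) ^ n - 2 ^ ((n + 1) / 2) + 1 := by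
  have hn0 : n ≠ 0 := by omega
  obtain ⟨ε, hε, hnorm⟩ := exists_norm_one_sub_pow_eq hodd
  have hε2 : ε ^ 2 = 1 := by rcases hε with rfl | rfl <;> norm_num
  set F := (cyclotomic n GaussianInt).eval ⟨ε, ε⟩
  have hFt : Zsqrtd.norm F ∣ (2 : ℤ) ^ n - 2 ^ ((n + 1) / 2) + 1 := by
    rw [← hnorm]
    have h : F ∣ 1 - (⟨ε, ε⟩ : GaussianInt) ^ n := by
      rw [dvd_sub_comm]
      simpa using
        eval_dvd (x := (⟨ε, ε⟩ : GaussianInt)) (cyclotomic.dvd_X_pow_sub_one n GaussianInt)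
    exact map_dvd Zsqrtd.normMonoidHom h
  have ht : (2 : ℤ) ^ n - 2 ^ ((n + 1) / 2) + 1 ∣ (2 ^ n) ^ 2 + 1 := by
    refine ⟨2 ^ n + 2 ^ ((n + 1) / 2) + 1, ?_⟩
    have h : ((2 : ℤ) ^ ((n + 1) / 2)) ^ 2 = 2 * 2 ^ n := by
      rw [← pow_mul, ← pow_succ']
      obtain ⟨j, rfl⟩ := hodd
      congr 1
      omega
    linear_combination h
  obtain ⟨p, hpmem, hpmax⟩ := Finset.exists_max_image n.primeFactors id
    (Nat.nonempty_primeFactors.mpr (by omega))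
  have hp := Nat.prime_of_mem_primeFactors hpmem
  have hpn := Nat.dvd_of_mem_primeFactors hpmem
  have hmax : ∀ r : ℕ, r.Prime → r ∣ n → r ≤ p := fun r hr hrn =>
    hpmax r (Nat.mem_primeFactors.mpr ⟨hr, hrn, hn0⟩)
  have hsize : (p : ℤ) < Zsqrtd.norm F := by
    have hw : ‖GaussianInt.toComplex ⟨ε, ε⟩‖ ^ 2 = 2 := by
      rw [← Complex.normSq_eq_norm_sq, GaussianInt.toComplex_def', Complex.normSq_apply]
      have : (ε : ℝ) ^ 2 = 1 := by exact_mod_cast hε2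
      simp
      linarith
    have h := lt_normSq_eval_cyclotomic hodd hn hp hpn hmax hw
    rw [cyclotomic.eval_apply, ← Complex.normSq_eq_norm_sq] at h
    have h2 : ((Zsqrtd.norm F : ℤ) : ℝ) = Complex.normSq (GaussianInt.toComplex F) := by
      exact_mod_cast GaussianInt.intCast_complex_norm F
    rw [← h2] at h
    exact_mod_cast h
  have hodd_of_dvd : ∀ ℓ : ℕ, ℓ.Prime → (ℓ : ℤ) ∣ (2 ^ n) ^ 2 + 1 → ¬ (ℓ : ℤ) ∣ 2 := by
    intro ℓ hℓ h h2
    have h1 := (dvd_add_right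
      ((h2.trans (dvd_pow_self 2 hn0)).trans (dvd_pow_self _ two_ne_zero))).mp h
    exact hℓ.one_lt.ne' (by exact_mod_cast Int.eq_one_of_dvd_one (by positivity) h1)
  by_contra! hno
  have hunique : ∀ {ℓ : ℕ}, ℓ.Prime → ℓ ∣ (Zsqrtd.norm F).natAbs → ℓ = p := by
    intro ℓ hℓ hdvd
    rw [← Int.natCast_dvd] at hdvd
    have ha := (hdvd.trans hFt).trans ht
    have hℓ2 := hodd_of_dvd ℓ hℓ ha
    have := Fact.mk hℓ
    obtain ⟨x, hx8, hx⟩ : ∃ x : ℤ, (x : ZMod ℓ) ^ 8 = 2 ^ 4 ∧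
        (ℓ : ℤ) ∣ (cyclotomic n ℤ).eval x := by
      have haZ : ((2 : ZMod ℓ) ^ n) ^ 2 + 1 = 0 := by
        rw [← ZMod.intCast_zmod_eq_zero_iff_dvd] at ha
        exact_mod_cast ha
      have hεZ : (ε : ZMod ℓ) ^ 2 = 1 := by exact_mod_cast congrArg (Int.cast : ℤ → ZMod ℓ) hε2
      have h8 : ∀ b : ZMod ℓ, b ^ 2 + 1 = 0 → (ε * (1 + b)) ^ 8 = 2 ^ 4 := by
        intro b hb
        have h1 : (ε * (1 + b)) ^ 2 = 2 * b := by linear_combination (1 + b) ^ 2 * hεZ + hb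
        rw [show (ε * (1 + b)) ^ 8 = ((ε * (1 + b)) ^ 2) ^ 4 by ring, h1]
        linear_combination 2 ^ 4 * (b ^ 2 - 1) * hb
      rcases (Nat.prime_iff_prime_int.mp hℓ).dvd_or_dvd
        (dvd_eval_cyclotomic_mul_of_dvd_norm ha hdvd) with h | h
      · refine ⟨_, ?_, h⟩
        simpa using h8 _ haZ
      · refine ⟨_, ?_, h⟩
        simpa [sub_eq_add_neg] using h8 (-2 ^ n) (by rw [neg_sq]; exact haZ)
    by_cases hℓn : ℓ ∣ n
    · exact le_antisymm (hmax ℓ hℓ hℓn) (prime_le_of_dvd_eval_cyclotomic hn0 hℓ hp hpn hx)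
    exfalso
    have haZ : ((2 : ZMod ℓ) ^ n) ^ 2 = -1 := by
      rw [← ZMod.intCast_zmod_eq_zero_iff_dvd] at ha
      push_cast at ha
      linear_combination ha
    refine hno ℓ hℓ ?_ ?_ (hdvd.trans hFt)
    · refine ha.trans ⟨(2 ^ n) ^ 2 - 1, ?_⟩
      rw [mul_comm 4, pow_mul]
      ring
    · intro i hi hi4 hdi
      have : NeZero (n : ZMod ℓ) := ⟨by rwa [Ne, ZMod.natCast_eq_zero_iff]⟩
      have hprim : IsPrimitiveRoot (x : ZMod ℓ) n := by
        rw [← isRoot_cyclotomic_iff]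
        rw [← ZMod.intCast_zmod_eq_zero_iff_dvd] at hx
        simpa [IsRoot, hx] using cyclotomic.eval_apply x n (Int.castRingHom (ZMod ℓ))
      rw [← ZMod.intCast_zmod_eq_zero_iff_dvd] at hℓ2 hdi
      push_cast at hℓ2 hdi
      have h4 := four_mul_dvd_of_two_pow_eq_one hodd hℓ2 hprim hx8 haZ (sub_eq_zero.mp hdi)
      exact absurd (Nat.le_of_dvd hi h4) (by omega)
  have hsq : ¬ ((p ^ 2 : ℕ) : ℤ) ∣ Zsqrtd.norm F := by
    intro hdvd
    have ha := (hdvd.trans hFt).trans ht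
    have hpa : (p : ℤ) ∣ (2 ^ n) ^ 2 + 1 :=
      (Int.natCast_dvd_natCast.mpr (dvd_pow_self p two_ne_zero)).trans ha
    have hpI := Nat.prime_iff_prime_int.mp hp
    have hAB := dvd_eval_cyclotomic_mul_of_dvd_norm ha hdvd
    push_cast at hAB
    have hroot : ∀ x : ℤ, (p : ℤ) ∣ (cyclotomic n ℤ).eval x → (x : ZMod p) ^ n = 1 := by
      intro x hx
      have h := hx.trans (eval_dvd (x := x) (cyclotomic.dvd_X_pow_sub_one n ℤ))
      rw [← ZMod.intCast_zmod_eq_zero_iff_dvd] at h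
      simpa [sub_eq_zero] using h
    have hnsq := not_sq_dvd_eval_cyclotomic hn0 hp (hodd.of_dvd_nat hpn) hpn
    by_cases hA : (p : ℤ) ∣ (cyclotomic n ℤ).eval (ε * (1 + 2 ^ n))
    · by_cases hB : (p : ℤ) ∣ (cyclotomic n ℤ).eval (ε * (1 - 2 ^ n))
      · have h1 := congrArg₂ (· * ·) (hroot _ hA) (hroot _ hB)
        have h2 := hodd_of_dvd p hp hpa
        rw [← ZMod.intCast_zmod_eq_zero_iff_dvd] at hpa h2
        push_cast at hpa h1 h2
        have hεZ : (ε : ZMod p) ^ 2 = 1 := by exact_mod_cast congrArg (Int.cast : ℤ → ZMod p) hε2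
        rw [← mul_pow, show (ε : ZMod p) * (1 + 2 ^ n) * (ε * (1 - 2 ^ n)) = 2 by
          linear_combination (1 - (2 ^ n) ^ 2) * hεZ - hpa] at h1
        rw [mul_one] at h1
        rw [h1] at hpa
        exact h2 (by linear_combination hpa)
      · exact hnsq _ (hpI.pow_dvd_of_dvd_mul_right 2 hB hAB)
    · exact hnsq _ (hpI.pow_dvd_of_dvd_mul_left 2 hA hAB)
  have hpow := Nat.eq_prime_pow_of_unique_prime_dvd (n := (Zsqrtd.norm F).natAbs) (by omega) hunique
  set j := (Zsqrtd.norm F).natAbs.primeFactorsList.length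
  rw [Int.natCast_dvd, hpow, Nat.pow_dvd_pow_iff_le_right hp.one_lt] at hsq
  have hle := Nat.pow_le_pow_right hp.pos (show j ≤ 1 by omega)
  rw [pow_one] at hle
  omega
end

section
/- Let q = 2^n with n odd. Then t⁺(q) := q + 2^{(n+1)/2} + 1 is divisible by a primitive prime divisor of 2^{4n} − 1. -/
open Polynomial

/-- The Gaussian integer `s * (1 + i)`, for a sign `s`. -/
def gaussBase (s : ℤˣ) : GaussianInt := ⟨s, s⟩

/-- The norm of the value of the `d`-th cyclotomic polynomial at `gaussBase s`. -/
noncomputable def cyclotomicNorm (s : ℤˣ) (d : ℕ) : ℕ :=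
  (((cyclotomic d GaussianInt).eval (gaussBase s)).norm).natAbs

theorem cast_cyclotomicNorm (s : ℤˣ) (d : ℕ) :
    (cyclotomicNorm s d : ℤ) = ((cyclotomic d GaussianInt).eval (gaussBase s)).norm :=
  Int.natAbs_of_nonneg (GaussianInt.norm_nonneg _)

theorem gaussBase_sq (s : ℤˣ) : gaussBase s ^ 2 = ⟨0, 2⟩ := by
  rcases Int.units_eq_one_or s with rfl | rfl <;> rfl

theorem gaussBase_pow_eight (s : ℤˣ) : gaussBase s ^ 8 = 16 := by
  rcases Int.units_eq_one_or s with rfl | rfl <;> rfl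

/-- Odd powers of `s * (1 + i)` lie on the diagonals. -/
theorem exists_gaussBase_pow_odd (k : ℕ) :
    ∃ a b : ℤˣ, ∀ s : ℤˣ, gaussBase s ^ (2 * k + 1) = ⟨s * (a * 2 ^ k), s * (b * 2 ^ k)⟩ := by
  induction k with
  | zero => exact ⟨1, 1, fun s => by simp [gaussBase]⟩
  | succ k ih =>
    obtain ⟨a, b, h⟩ := ih
    refine ⟨-b, a, fun s => ?_⟩
    rw [show 2 * (k + 1) + 1 = 2 + (2 * k + 1) by ring, pow_add, h, gaussBase_sq]
    ext <;> simp <;> ring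

theorem exists_norm_gaussBase_pow_sub_one (k : ℕ) :
    ∃ a : ℤˣ, ∀ s : ℤˣ, (gaussBase s ^ (2 * k + 1) - 1).norm =
      2 ^ (2 * k + 1) + s * a * 2 ^ (k + 1) + 1 := by
  obtain ⟨a, b, h⟩ := exists_gaussBase_pow_odd k
  refine ⟨-a, fun s => ?_⟩
  have ha : (a : ℤ) ^ 2 = 1 := by rcases Int.units_eq_one_or a with rfl | rfl <;> rfl
  have hb : (b : ℤ) ^ 2 = 1 := by rcases Int.units_eq_one_or b with rfl | rfl <;> rfl
  have hs : (s : ℤ) ^ 2 = 1 := by rcases Int.units_eq_one_or s with rfl | rfl <;> rfl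
  rw [h, Zsqrtd.norm_def]
  simp only [Zsqrtd.re_sub, Zsqrtd.im_sub, Zsqrtd.re_one, Zsqrtd.im_one, Units.val_neg]
  linear_combination (2 ^ k) ^ 2 * (s : ℤ) ^ 2 * ha + (2 ^ k) ^ 2 * (s : ℤ) ^ 2 * hb +
    2 * (2 ^ k) ^ 2 * hs

theorem norm_gaussBase_mul_norm_gaussBase_neg (s : ℤˣ) {d : ℕ} (hd : Odd d) :
    (gaussBase s ^ d - 1).norm * (gaussBase (-s) ^ d - 1).norm = 2 ^ (2 * d) + 1 := by
  obtain ⟨k, rfl⟩ := hd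
  obtain ⟨a, h⟩ := exists_norm_gaussBase_pow_sub_one k
  have ha : (a : ℤ) ^ 2 = 1 := by rcases Int.units_eq_one_or a with rfl | rfl <;> rfl
  have hs : (s : ℤ) ^ 2 = 1 := by rcases Int.units_eq_one_or s with rfl | rfl <;> rfl
  rw [h, h, Units.val_neg]
  linear_combination (-(2 ^ (k + 1)) ^ 2 * (s : ℤ) ^ 2) * ha - (2 ^ (k + 1)) ^ 2 * hs

theorem norm_gaussBase_pow_sub_one_dvd (s : ℤˣ) {d : ℕ} (hd : Odd d) :
    (gaussBase s ^ d - 1).norm ∣ 2 ^ (2 * d) + 1 :=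
  ⟨_, (norm_gaussBase_mul_norm_gaussBase_neg s hd).symm⟩

theorem norm_dvd_norm {x y : GaussianInt} (h : x ∣ y) : x.norm ∣ y.norm :=
  map_dvd Zsqrtd.normMonoidHom h

theorem prod_cyclotomicNorm (s : ℤˣ) {n : ℕ} (hn : 0 < n) :
    ∏ d ∈ n.divisors, (cyclotomicNorm s d : ℤ) = (gaussBase s ^ n - 1).norm := by
  have h := congrArg (fun p => Zsqrtd.normMonoidHom (p.eval (gaussBase s)))
    (prod_cyclotomic_eq_X_pow_sub_one hn GaussianInt)
  simp only [eval_prod, map_prod, eval_sub, eval_pow, eval_X, eval_one] at h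
  simp only [cast_cyclotomicNorm]
  exact h

theorem cyclotomicNorm_dvd (s : ℤˣ) {n : ℕ} (hn : 0 < n) :
    (cyclotomicNorm s n : ℤ) ∣ (gaussBase s ^ n - 1).norm := by
  rw [← prod_cyclotomicNorm s hn]
  exact Finset.dvd_prod_of_mem _ (Nat.mem_divisors_self n hn.ne')

theorem norm_mul_cyclotomicNorm_dvd (s : ℤˣ) {d n : ℕ} (h : d ∈ n.properDivisors) :
    (gaussBase s ^ d - 1).norm * cyclotomicNorm s n ∣ (gaussBase s ^ n - 1).norm := by
  have h := norm_dvd_norm (eval_dvd (x := gaussBase s)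
    (X_pow_sub_one_mul_cyclotomic_dvd_X_pow_sub_one_of_dvd GaussianInt h))
  simpa [Zsqrtd.norm_mul, cast_cyclotomicNorm] using h

/-! ### Size -/

theorem abs_log_one_add_sign_mul_le {x : ℝ} (hx : 0 ≤ x) (c : ℤˣ) :
    0 < 1 + (c : ℤ) * x + x ^ 2 / 2 ∧ |Real.log (1 + (c : ℤ) * x + x ^ 2 / 2)| ≤ x := by
  have hexp := Real.quadratic_le_exp_of_nonneg hx
  have hpos : 0 < 1 + x + x ^ 2 / 2 := by positivity
  have hneg : 0 < 1 - x + x ^ 2 / 2 := by nlinarith [sq_nonneg (x - 1)]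
  have hlog : Real.log (1 + x + x ^ 2 / 2) ≤ x := (Real.log_le_iff_le_exp hpos).2 hexp
  rcases Int.units_eq_one_or c with rfl | rfl
  · simp only [Units.val_one, Int.cast_one, one_mul]
    refine ⟨hpos, abs_le.2 ⟨?_, hlog⟩⟩
    have := Real.log_nonneg (show 1 ≤ 1 + x + x ^ 2 / 2 by nlinarith [sq_nonneg x])
    linarith
  · simp only [Units.val_neg, Units.val_one, Int.cast_neg, Int.cast_one, neg_one_mul,
      ← sub_eq_add_neg]
    refine ⟨hneg, abs_le.2 ⟨?_, ?_⟩⟩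
    · have hmul : 0 ≤ Real.log ((1 + x + x ^ 2 / 2) * (1 - x + x ^ 2 / 2)) :=
        Real.log_nonneg (by nlinarith [sq_nonneg (x ^ 2)])
      rw [Real.log_mul hpos.ne' hneg.ne'] at hmul
      linarith
    · exact (Real.log_le_log hneg (by linarith)).trans hlog

/-- For odd `n`, the norm of `gaussBase s ^ n - 1` is close to `2 ^ n`. -/
theorem abs_log_norm_sub_le (s : ℤˣ) (k : ℕ) :
    0 < (gaussBase s ^ (2 * k + 1) - 1).norm ∧
    |Real.log ((gaussBase s ^ (2 * k + 1) - 1).norm : ℝ) - (2 * k + 1 : ℕ) * Real.log 2| ≤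
      (1 / 2) ^ k := by
  obtain ⟨a, h⟩ := exists_norm_gaussBase_pow_sub_one k
  obtain ⟨hpos, hle⟩ := abs_log_one_add_sign_mul_le (x := (1 / 2) ^ k) (by positivity) (s * a)
  have key : ((gaussBase s ^ (2 * k + 1) - 1).norm : ℝ) =
      2 ^ (2 * k + 1) * (1 + ((s * a : ℤˣ) : ℤ) * (1 / 2) ^ k + ((1 / 2) ^ k) ^ 2 / 2) := by
    have h2 : (2 : ℝ) ^ k * (1 / 2) ^ k = 1 := by rw [← mul_pow]; norm_num
    rw [h]
    push_cast
    linear_combination (-2 * (2 : ℝ) ^ k * s * a - 1 - (2 : ℝ) ^ k * (1 / 2) ^ k) * h2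
  refine ⟨?_, ?_⟩
  · have : (0 : ℝ) < (gaussBase s ^ (2 * k + 1) - 1).norm := by rw [key]; positivity
    exact_mod_cast this
  · rw [key, Real.log_mul (by positivity) hpos.ne', Real.log_pow, add_sub_cancel_left]
    exact hle

theorem sum_divisors_half_pow_le {n : ℕ} (hn : Odd n) :
    ∑ d ∈ n.divisors, ((1 : ℝ) / 2) ^ (d / 2) ≤ 2 := by
  have hinj : Set.InjOn (fun d => d / 2) (n.divisors : Set ℕ) := by
    intro x hx y hy hxy
    have hx' := hn.of_dvd_nat (Nat.dvd_of_mem_divisors hx)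
    have hy' := hn.of_dvd_nat (Nat.dvd_of_mem_divisors hy)
    obtain ⟨u, rfl⟩ := hx'
    obtain ⟨v, rfl⟩ := hy'
    simp only at hxy
    omega
  rw [← Finset.sum_image (f := fun k => ((1 : ℝ) / 2) ^ k) hinj]
  refine (Finset.sum_le_sum_of_subset_of_nonneg (t := Finset.range (n + 1)) ?_ ?_).trans
    (sum_geometric_two_le (n + 1))
  · intro k hk
    obtain ⟨d, hd, rfl⟩ := Finset.mem_image.1 hk
    have := Nat.divisor_le hd
    simp only [Finset.mem_range]
    omega
  · intros
    positivity

theorem abs_le_two_of_abs_sum_divisors_le {F : ℕ → ℝ}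
    (hF : ∀ d, Odd d → |∑ i ∈ d.divisors, F i| ≤ (1 / 2) ^ (d / 2)) {n : ℕ} (hn : Odd n) :
    |F n| ≤ 2 := by
  have hinv := ArithmeticFunction.sum_eq_iff_sum_mul_moebius_eq.1
    (fun d (_ : d > 0) => (rfl : ∑ i ∈ d.divisors, F i = (fun d => ∑ i ∈ d.divisors, F i) d))
    n hn.pos
  rw [← hinv]
  refine (Finset.abs_sum_le_sum_abs _ _).trans (le_trans (Finset.sum_le_sum (g :=
    fun x : ℕ × ℕ => ((1 : ℝ) / 2) ^ (x.2 / 2)) fun x hx => ?_) ?_)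
  · have hx2 : Odd x.2 := hn.of_dvd_nat ⟨x.1, by
      rw [mul_comm]; exact (Nat.mem_divisorsAntidiagonal.1 hx).1.symm⟩
    have hmu : |((ArithmeticFunction.moebius x.1 : ℤ) : ℝ)| ≤ 1 := by
      exact_mod_cast ArithmeticFunction.abs_moebius_le_one
    rw [abs_mul]
    exact (mul_le_of_le_one_left (abs_nonneg _) hmu).trans (hF _ hx2)
  · rw [Nat.sum_divisorsAntidiagonal' (fun _ d => ((1 : ℝ) / 2) ^ (d / 2))]
    exact sum_divisors_half_pow_le hn

theorem totient_mul_log_two_sub_two_le_log (s : ℤˣ) {n : ℕ} (hn : Odd n) :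
    n.totient * Real.log 2 - 2 ≤ Real.log (cyclotomicNorm s n) := by
  have habs := abs_le_two_of_abs_sum_divisors_le
    (F := fun d => Real.log (cyclotomicNorm s d) - d.totient * Real.log 2) (fun d hd => ?_) hn
  · linarith [(abs_le.1 habs).1]
  obtain ⟨k, rfl⟩ := hd
  obtain ⟨hpos, hle⟩ := abs_log_norm_sub_le s k
  have hprod := prod_cyclotomicNorm s (n := 2 * k + 1) (by omega)
  have hne : ∀ i ∈ (2 * k + 1).divisors, (cyclotomicNorm s i : ℝ) ≠ 0 := by
    intro i hi h0
    have h0' : (cyclotomicNorm s i : ℤ) = 0 := by exact_mod_cast h0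
    rw [Finset.prod_eq_zero hi h0'] at hprod
    exact hpos.ne hprod
  have hprod' : ∏ i ∈ (2 * k + 1).divisors, (cyclotomicNorm s i : ℝ) =
      (gaussBase s ^ (2 * k + 1) - 1).norm := by
    rw [← hprod]
    push_cast
    rfl
  rw [Finset.sum_sub_distrib, ← Finset.sum_mul, ← Nat.cast_sum, Nat.sum_totient,
    ← Real.log_prod hne, hprod', show (2 * k + 1) / 2 = k by omega]
  exact hle

theorem two_pow_totient_lt (s : ℤˣ) {n : ℕ} (hn : Odd n) (h0 : cyclotomicNorm s n ≠ 0) :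
    2 ^ n.totient < 8 * cyclotomicNorm s n := by
  have h := totient_mul_log_two_sub_two_le_log s hn
  have hexp : Real.exp 2 < 8 := by
    rw [show (2 : ℝ) = 1 + 1 by norm_num, Real.exp_add]
    nlinarith [Real.exp_one_lt_d9, Real.exp_pos 1]
  have hQ : (0 : ℝ) < cyclotomicNorm s n := by positivity
  have : (2 : ℝ) ^ n.totient < 8 * cyclotomicNorm s n := by
    rw [← Real.log_lt_log_iff (by positivity) (by positivity), Real.log_pow,
      Real.log_mul (by norm_num) hQ.ne']
    have := (Real.lt_log_iff_exp_lt (by norm_num)).2 hexp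
    linarith
  exact_mod_cast this

theorem Odd.exists_mul_of_not_prime {m : ℕ} (hm : Odd m) (h1 : m ≠ 1) (hp : ¬ m.Prime) :
    ∃ a b, m = a * b ∧ Odd a ∧ Odd b ∧ 3 ≤ a ∧ 3 ≤ b := by
  obtain ⟨a, ⟨b, rfl⟩, ha, hab⟩ := Nat.exists_dvd_of_not_prime (by
    have := hm.pos
    omega) hp
  obtain ⟨⟨u, rfl⟩, ⟨v, rfl⟩⟩ := Nat.odd_mul.1 hm
  refine ⟨_, _, rfl, ⟨u, rfl⟩, ⟨v, rfl⟩, by omega, ?_⟩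
  rcases Nat.eq_zero_or_pos v with rfl | hv
  · simp at hab
  · omega

theorem two_le_totient {m : ℕ} (h3 : 3 ≤ m) : 2 ≤ m.totient :=
  Nat.le_of_dvd (Nat.totient_pos.2 (by omega)) (Nat.totient_even h3).two_dvd

theorem four_le_totient {m : ℕ} (hm : Odd m) (h5 : 5 ≤ m) : 4 ≤ m.totient := by
  by_cases hp : m.Prime
  · rw [Nat.totient_prime hp]
    omega
  · obtain ⟨a, b, rfl, -, -, ha, hb⟩ := hm.exists_mul_of_not_prime (by omega) hp
    exact (Nat.mul_le_mul (two_le_totient ha) (two_le_totient hb)).trans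
      (Nat.totient_super_multiplicative a b)

theorem six_le_totient {m : ℕ} (hm : Odd m) (h7 : 7 ≤ m) : 6 ≤ m.totient := by
  by_cases hp : m.Prime
  · rw [Nat.totient_prime hp]
    omega
  · obtain ⟨a, b, rfl, hao, hbo, ha, hb⟩ := hm.exists_mul_of_not_prime (by omega) hp
    have hmul := Nat.totient_super_multiplicative a b
    have ha2 := two_le_totient ha
    have hb2 := two_le_totient hb
    by_cases ha5 : 5 ≤ a
    · have := four_le_totient hao ha5
      nlinarith
    by_cases hb5 : 5 ≤ b
    · have := four_le_totient hbo hb5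
      nlinarith
    have ha3 : a = 3 := by
      obtain ⟨u, rfl⟩ := hao
      omega
    have hb3 : b = 3 := by
      obtain ⟨u, rfl⟩ := hbo
      omega
    subst ha3 hb3
    decide

/-! ### Prime divisors -/

theorem exists_ringHom_eq_zero {ℓ : ℕ} [Fact ℓ.Prime] {r : ZMod ℓ} (hr : r * r = -1)
    {x : GaussianInt} (hx : (ℓ : ℤ) ∣ x.norm) : ∃ ψ : GaussianInt →+* ZMod ℓ, ψ x = 0 := by
  let ψ : GaussianInt →+* ZMod ℓ := Zsqrtd.lift ⟨r, by simpa using hr⟩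
  have h : ψ x * ψ (star x) = 0 := by
    rw [← map_mul, ← Zsqrtd.norm_eq_mul_conj, map_intCast]
    exact (ZMod.intCast_zmod_eq_zero_iff_dvd _ _).2 hx
  rcases mul_eq_zero.1 h with h | h
  · exact ⟨ψ, h⟩
  · exact ⟨ψ.comp (starRingEnd GaussianInt), h⟩

theorem two_pow_eq_neg_one (s : ℤˣ) {n ℓ : ℕ} (hn : Odd n) (h : ℓ ∣ cyclotomicNorm s n) :
    (2 : ZMod ℓ) ^ (2 * n) = -1 := by
  have h1 : (ℓ : ℤ) ∣ 2 ^ (2 * n) + 1 := (Int.natCast_dvd_natCast.2 h).trans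
    ((cyclotomicNorm_dvd s hn.pos).trans (norm_gaussBase_pow_sub_one_dvd s hn))
  have h2 := (ZMod.intCast_zmod_eq_zero_iff_dvd _ _).2 h1
  push_cast at h2
  exact eq_neg_of_add_eq_zero_left h2

theorem exists_isPrimitiveRoot (s : ℤˣ) {k m ℓ : ℕ} [Fact ℓ.Prime] (hn : Odd (ℓ ^ k * m))
    (hm : ¬ ℓ ∣ m) (h : ℓ ∣ cyclotomicNorm s (ℓ ^ k * m)) :
    ∃ b : ZMod ℓ, b ^ 8 = 16 ∧ IsPrimitiveRoot b m := by
  have h2 := two_pow_eq_neg_one s hn h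
  have hr : (2 : ZMod ℓ) ^ (ℓ ^ k * m) * 2 ^ (ℓ ^ k * m) = -1 := by
    rw [← h2, ← pow_add, two_mul]
  have hx : (ℓ : ℤ) ∣ ((cyclotomic (ℓ ^ k * m) GaussianInt).eval (gaussBase s)).norm := by
    rw [← cast_cyclotomicNorm]
    exact_mod_cast h
  obtain ⟨ψ, hψ⟩ := exists_ringHom_eq_zero hr hx
  have : NeZero (m : ZMod ℓ) := ⟨fun h0 => hm ((ZMod.natCast_eq_zero_iff _ _).1 h0)⟩
  refine ⟨ψ (gaussBase s), ?_, ?_⟩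
  · rw [← map_pow, gaussBase_pow_eight, map_ofNat]
  · rw [← isRoot_cyclotomic_prime_pow_mul_iff_of_charP (p := ℓ) (k := k), IsRoot.def,
      ← map_cyclotomic _ ψ, eval_map, eval₂_at_apply, hψ]

theorem odd_of_dvd_cyclotomicNorm (s : ℤˣ) {n ℓ : ℕ} (hn : Odd n)
    (h : ℓ ∣ cyclotomicNorm s n) : Odd ℓ := by
  have h1 : (ℓ : ℤ) ∣ 2 ^ (2 * n) + 1 := (Int.natCast_dvd_natCast.2 h).trans
    ((cyclotomicNorm_dvd s hn.pos).trans (norm_gaussBase_pow_sub_one_dvd s hn))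
  have h2 : Odd (2 ^ (2 * n) + 1) :=
    (even_two.pow_of_ne_zero (by have := hn.pos; omega)).add_one
  exact h2.of_dvd_nat (by exact_mod_cast h1)

/-- A prime divisor of `cyclotomicNorm s n` not dividing `n` is a primitive prime divisor of
`2 ^ (4 * n) - 1`. -/
theorem not_dvd_two_pow_sub_one (s : ℤˣ) {n ℓ : ℕ} (hℓ : ℓ.Prime) (hn : Odd n)
    (h : ℓ ∣ cyclotomicNorm s n) (hℓn : ¬ ℓ ∣ n) {i : ℕ} (hi : 1 ≤ i) (hin : i < 4 * n) :
    ¬ (ℓ : ℤ) ∣ 2 ^ i - 1 := by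
  intro hdvd
  have : Fact ℓ.Prime := ⟨hℓ⟩
  have hodd := odd_of_dvd_cyclotomicNorm s hn h
  have : Fact (2 < ℓ) := ⟨by
    have := hℓ.two_le
    rcases hodd with ⟨u, rfl⟩
    omega⟩
  have hneg : (-1 : ZMod ℓ) ≠ 1 := ZMod.neg_one_ne_one
  have h2 := two_pow_eq_neg_one s hn h
  have h3 : (2 : ZMod ℓ) ^ i = 1 := by
    have := (ZMod.intCast_zmod_eq_zero_iff_dvd _ _).2 hdvd
    push_cast at this
    exact sub_eq_zero.1 this
  obtain ⟨b, hb, hprim⟩ := exists_isPrimitiveRoot s (k := 0) (m := n) (ℓ := ℓ)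
    (by simpa using hn) hℓn (by simpa using h)
  have hni : n ∣ 8 * i := hprim.dvd_of_pow_eq_one _ (by
    rw [pow_mul, hb, show (16 : ZMod ℓ) = 2 ^ 4 by norm_num, ← pow_mul, mul_comm, pow_mul, h3,
      one_pow])
  have hcop : n.Coprime 8 := by
    rw [show 8 = 2 ^ 3 by norm_num]
    exact (Nat.coprime_two_right.2 hn).pow_right 3
  obtain ⟨c, rfl⟩ := hcop.dvd_of_dvd_mul_left hni
  have hc : c < 4 := by
    rw [mul_comm 4] at hin
    exact lt_of_mul_lt_mul_left hin (Nat.zero_le _)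
  have h4 : (-1 : ZMod ℓ) ^ c = 1 := by
    rw [← h2, ← pow_mul, show 2 * n * c = n * c * 2 by ring, pow_mul, h3, one_pow]
  interval_cases c
  · omega
  · exact hneg (by simpa using h4)
  · exact hneg (by rw [← h2, ← h3, mul_comm])
  · exact hneg (by simpa [pow_succ] using h4)

/-- A prime divisor of `cyclotomicNorm s n` is at least every prime divisor of `n`. -/
theorem le_of_dvd_cyclotomicNorm (s : ℤˣ) {n ℓ p : ℕ} (hℓ : ℓ.Prime) (hn : Odd n)
    (h : ℓ ∣ cyclotomicNorm s n) (hp : p.Prime) (hpn : p ∣ n) : p ≤ ℓ := by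
  have : Fact ℓ.Prime := ⟨hℓ⟩
  obtain ⟨k, m, hm, rfl⟩ := Nat.exists_eq_pow_mul_and_not_dvd hn.pos.ne' ℓ hℓ.ne_one
  obtain ⟨b, hb, hprim⟩ := exists_isPrimitiveRoot s hn hm h
  rcases hp.dvd_mul.1 hpn with hp1 | hp1
  · exact Nat.le_of_dvd hℓ.pos (hp.dvd_of_dvd_pow hp1)
  · have hb0 : b ≠ 0 := hprim.ne_zero (by rintro rfl; simp at hm)
    have hdvd := hp1.trans (hprim.dvd_of_pow_eq_one _ (ZMod.pow_card_sub_one_eq_one hb0))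
    have := hℓ.two_le
    have := Nat.le_of_dvd (by omega) hdvd
    omega

theorem not_sq_dvd_cyclotomicNorm (s : ℤˣ) {n ℓ : ℕ} (hℓ : ℓ.Prime) (hn : Odd n)
    (hℓn : ℓ ∣ n) : ¬ ℓ ^ 2 ∣ cyclotomicNorm s n := by
  intro h
  have : Fact ℓ.Prime := ⟨hℓ⟩
  have h1 : ℓ ∣ cyclotomicNorm s n := (dvd_pow_self ℓ two_ne_zero).trans h
  have h2 := two_pow_eq_neg_one s hn h1
  have hodd := odd_of_dvd_cyclotomicNorm s hn h1
  obtain ⟨d, rfl⟩ := hℓn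
  have hd : Odd d := (Nat.odd_mul.1 hn).2
  have hmem : d ∈ (ℓ * d).properDivisors := Nat.mem_properDivisors.2
    ⟨dvd_mul_left _ _, lt_mul_of_one_lt_left hd.pos hℓ.one_lt⟩
  have hdvd : ((2 : ℤ) ^ (2 * d) + 1) * ℓ ^ 2 ∣ 2 ^ (2 * (ℓ * d)) + 1 := by
    rw [← norm_gaussBase_mul_norm_gaussBase_neg s hd, ← norm_gaussBase_mul_norm_gaussBase_neg s hn,
      mul_right_comm]
    refine mul_dvd_mul ((mul_dvd_mul_left _ ?_).trans (norm_mul_cyclotomicNorm_dvd s hmem))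
      ((dvd_mul_right _ _).trans (norm_mul_cyclotomicNorm_dvd (-s) hmem))
    exact_mod_cast h
  have hdvd' : (2 ^ (2 * d) + 1) * ℓ ^ 2 ∣ (2 ^ (2 * d)) ^ ℓ + 1 ^ ℓ := by
    rw [one_pow, ← pow_mul, show 2 * d * ℓ = 2 * (ℓ * d) by ring]
    exact_mod_cast hdvd
  have hbase : ℓ ∣ 2 ^ (2 * d) + 1 := by
    rw [← ZMod.natCast_eq_zero_iff]
    push_cast
    rw [show 2 * (ℓ * d) = 2 * d * ℓ by ring, pow_mul, ZMod.pow_card] at h2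
    rw [h2, neg_add_cancel]
  have hnd : ¬ ℓ ∣ 2 ^ (2 * d) := fun hx => hℓ.one_lt.ne'
    (Nat.dvd_one.1 ((Nat.dvd_add_right hx).1 hbase))
  have hval := padicValNat.pow_add_pow hodd hbase hnd hodd
  have hle := (padicValNat_dvd_iff_le (p := ℓ) (n := padicValNat ℓ (2 ^ (2 * d) + 1) + 2)
    (by positivity : (2 ^ (2 * d)) ^ ℓ + 1 ^ ℓ ≠ 0)).1
    (by rw [pow_add]; exact (mul_dvd_mul_right pow_padicValNat_dvd _).trans hdvd')
  rw [hval, padicValNat_self] at hle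
  omega

theorem cyclotomicNorm_ne_zero (s : ℤˣ) {n : ℕ} (hn : Odd n) : cyclotomicNorm s n ≠ 0 := by
  intro h
  have hdvd := cyclotomicNorm_dvd s hn.pos
  obtain ⟨k, rfl⟩ := hn
  rw [h, Nat.cast_zero, zero_dvd_iff] at hdvd
  exact (abs_log_norm_sub_le s k).1.ne' hdvd

theorem exists_prime_dvd_cyclotomicNorm_not_dvd (s : ℤˣ) {n : ℕ} (hn : Odd n) (h7 : 7 ≤ n) :
    ∃ ℓ : ℕ, ℓ.Prime ∧ ℓ ∣ cyclotomicNorm s n ∧ ¬ ℓ ∣ n := by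
  by_contra! hall
  have hlt := two_pow_totient_lt s hn (cyclotomicNorm_ne_zero s hn)
  have h6 := six_le_totient hn h7
  have hpow : 8 * (n.totient + 1) < 2 ^ n.totient := by
    generalize n.totient = t at h6
    induction t, h6 using Nat.le_induction with
    | base => norm_num
    | succ t ht ih => rw [pow_succ]; omega
  have hne : cyclotomicNorm s n ≠ 1 := by omega
  obtain ⟨ℓ, hℓ, hdvd⟩ := Nat.exists_prime_and_dvd hne
  have hℓn := hall ℓ hℓ hdvd
  have heq : cyclotomicNorm s n = ℓ := by
    obtain ⟨c, hc⟩ := id hdvd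
    by_cases hc1 : c = 1
    · rw [hc, hc1, mul_one]
    obtain ⟨p, hp, hpc⟩ := Nat.exists_prime_and_dvd hc1
    have hpQ : p ∣ cyclotomicNorm s n := hc ▸ hpc.mul_left ℓ
    obtain rfl : p = ℓ := le_antisymm
      (le_of_dvd_cyclotomicNorm s hℓ hn hdvd hp (hall p hp hpQ))
      (le_of_dvd_cyclotomicNorm s hp hn hpQ hℓ hℓn)
    refine absurd ?_ (not_sq_dvd_cyclotomicNorm s hp hn hℓn)
    rw [hc, sq]
    exact mul_dvd_mul_left p hpc
  have hle := Nat.le_of_dvd (by omega) (Nat.totient_dvd_of_dvd hℓn)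
  rw [Nat.totient_prime hℓ] at hle
  omega

theorem ppd_divides_t_plus (n : ℕ) (hodd : Odd n) (hn : 0 < n) :
    ∃ ℓ : ℕ, ℓ.Prime ∧ (ℓ : ℤ) ∣ 2 ^ (4 * n) - 1 ∧
      (∀ i : ℕ, 1 ≤ i → i < 4 * n → ¬ (ℓ : ℤ) ∣ 2 ^ i - 1) ∧
      (ℓ : ℤ) ∣ (2 : ℤ) ^ n + 2 ^ ((n + 1) / 2) + 1 := by
  rcases lt_or_ge n 7 with hlt | h7
  · have hcases : n = 1 ∨ n = 3 ∨ n = 5 := by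
      obtain ⟨k, rfl⟩ := hodd
      omega
    rcases hcases with rfl | rfl | rfl
    · refine ⟨5, by norm_num, by norm_num, fun i h1 hi => ?_, by norm_num⟩
      interval_cases i <;> norm_num
    · refine ⟨13, by norm_num, by norm_num, fun i h1 hi => ?_, by norm_num⟩
      interval_cases i <;> norm_num
    · refine ⟨41, by norm_num, by norm_num, fun i h1 hi => ?_, by norm_num⟩
      interval_cases i <;> norm_num
  · obtain ⟨k, hk⟩ := id hodd
    obtain ⟨s, hnorm⟩ := exists_norm_gaussBase_pow_sub_one k
    have hs : (s : ℤ) * s = 1 := by rcases Int.units_eq_one_or s with rfl | rfl <;> rfl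
    obtain ⟨ℓ, hℓ, hdvd, hℓn⟩ := exists_prime_dvd_cyclotomicNorm_not_dvd s hodd h7
    have hnorm_dvd : (ℓ : ℤ) ∣ (gaussBase s ^ n - 1).norm :=
      (Int.natCast_dvd_natCast.2 hdvd).trans (cyclotomicNorm_dvd s hn)
    refine ⟨ℓ, hℓ, ?_, fun i h1 hi => not_dvd_two_pow_sub_one s hℓ hodd hdvd hℓn h1 hi, ?_⟩
    · refine (hnorm_dvd.trans (norm_gaussBase_pow_sub_one_dvd s hodd)).trans
        ⟨2 ^ (2 * n) - 1, ?_⟩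
      ring
    · rw [show (n + 1) / 2 = k + 1 by omega]
      rwa [hk, hnorm, hs, one_mul, ← hk] at hnorm_dvd
end

section
/- Let q = 3^n with n odd and n ≥ 3. Then t⁻(q) := q − 3^{(n+1)/2} + 1 is divisible by a primitive prime divisor of 3^{6n} − 1. -/
/-- The sign `±1` attached to `q` coprime to `6`: it is `1` iff `q ≡ ±1 [MOD 12]`. -/
def reeSign (q : ℕ) : ℤˣ := (-1) ^ ((q + 1) / 6)

/-- The integers `3 ^ k ± 3 ^ ((k + 1) / 2) + 1`. -/
def reeTorus (ε : ℤˣ) (k : ℕ) : ℤ := 3 ^ k + ε * 3 ^ ((k + 1) / 2) + 1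

theorem odd_reeTorus (ε : ℤˣ) (k : ℕ) : Odd (reeTorus ε k) := by
  have h1 : Odd ((3 : ℤ) ^ k) := Odd.pow (by decide)
  have h2 : Odd ((3 : ℤ) ^ ((k + 1) / 2)) := Odd.pow (by decide)
  have h3 : Odd (ε : ℤ) := by rcases Int.units_eq_one_or ε with rfl | rfl <;> decide
  exact (h1.add_odd (h3.mul h2)).add_one

theorem reeTorus_mul_neg (ε : ℤˣ) {k : ℕ} (hk : Odd k) :
    reeTorus ε k * reeTorus (-ε) k = 3 ^ (2 * k) - 3 ^ k + 1 := by
  obtain ⟨j, rfl⟩ := hk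
  have h : (2 * j + 1 + 1) / 2 = j + 1 := by omega
  have hε : (ε : ℤ) * ε = 1 := by
    rw [← Units.val_mul, Int.units_mul_self, Units.val_one]
  simp only [reeTorus, h, Units.val_neg]
  ring_nf
  rw [sq (ε : ℤ), hε]
  ring

theorem reeTorus_mul_cofactor (ε : ℤˣ) {k : ℕ} (hk : Odd k) :
    reeTorus ε k * ((3 ^ k + 1) * reeTorus (-ε) k) = 3 ^ (3 * k) + 1 := by
  rw [mul_left_comm, reeTorus_mul_neg ε hk]
  ring

theorem reeTorus_dvd_pow_add_one (ε : ℤˣ) {k : ℕ} (hk : Odd k) :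
    reeTorus ε k ∣ 3 ^ (3 * k) + 1 :=
  ⟨_, (reeTorus_mul_cofactor ε hk).symm⟩

theorem pow_le_three_mul_reeTorus (ε : ℤˣ) {k : ℕ} (hk : Odd k) :
    3 ^ k ≤ 3 * reeTorus ε k := by
  obtain ⟨j, rfl⟩ := hk
  have h : (2 * j + 1 + 1) / 2 = j + 1 := by omega
  have hj : (1 : ℤ) ≤ 3 ^ j := one_le_pow₀ (by norm_num)
  simp only [reeTorus, h, pow_succ, pow_mul']
  rcases Int.units_eq_one_or ε with rfl | rfl <;> push_cast <;> nlinarith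

theorem reeTorus_le_pow (ε : ℤˣ) {k : ℕ} (hk : Odd k) : reeTorus ε k ≤ 3 ^ (k + 1) := by
  obtain ⟨j, rfl⟩ := hk
  have h : (2 * j + 1 + 1) / 2 = j + 1 := by omega
  have hj : (1 : ℤ) ≤ 3 ^ j := one_le_pow₀ (by norm_num)
  simp only [reeTorus, h, pow_succ, pow_mul']
  rcases Int.units_eq_one_or ε with rfl | rfl <;> push_cast <;> nlinarith

theorem reeTorus_pos (ε : ℤˣ) {k : ℕ} (hk : Odd k) : 0 < reeTorus ε k := by
  have h := pow_le_three_mul_reeTorus ε hk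
  have : (0 : ℤ) < 3 ^ k := by positivity
  linarith

theorem isCoprime_three_of_dvd_pow_add_one {M : ℤ} {k : ℕ} (hk : k ≠ 0)
    (hM : M ∣ 3 ^ k + 1) : IsCoprime M 3 := by
  obtain ⟨c, hc⟩ := hM
  obtain ⟨j, rfl⟩ := Nat.exists_eq_succ_of_ne_zero hk
  exact ⟨c, -3 ^ j, by rw [mul_comm c, ← hc, Nat.succ_eq_add_one]; ring⟩

/-- Modulo a divisor of `3 ^ (3 * k) + 1`, the index of `reeTorus` may be divided by any factor
coprime to `6`, at the cost of a sign. -/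
theorem dvd_reeTorus_mul_iff {M : ℤ} {k q : ℕ} (ε : ℤˣ) (hk : Odd k)
    (hM : M ∣ 3 ^ (3 * k) + 1) (hq : q.Coprime 6) :
    M ∣ reeTorus ε (k * q) ↔ M ∣ reeTorus (ε * reeSign q) k := by
  have hX : (3 : ℤ) ^ (3 * k) ≡ -1 [ZMOD M] := by
    rw [Int.modEq_comm, Int.modEq_iff_dvd]; simpa using hM
  have hq6 : q % 6 = 1 ∨ q % 6 = 5 := by
    have h2 : ¬ 2 ∣ q := fun h => by
      have := Nat.dvd_gcd h (by norm_num : 2 ∣ 6)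
      rw [hq] at this; omega
    have h3 : ¬ 3 ∣ q := fun h => by
      have := Nat.dvd_gcd h (by norm_num : 3 ∣ 6)
      rw [hq] at this; omega
    omega
  obtain ⟨j, rfl⟩ := hk
  have hj : (2 * j + 1 + 1) / 2 = j + 1 := by omega
  set k := 2 * j + 1 with hkj
  rcases hq6 with h | h
  · obtain ⟨a, rfl⟩ : ∃ a, q = 6 * a + 1 := ⟨q / 6, by omega⟩
    have e1 : (6 * a + 1 + 1) / 6 = a := by omega
    have e2 : (k * (6 * a + 1) + 1) / 2 = 3 * k * a + (j + 1) := by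
      rw [show k * (6 * a + 1) + 1 = 2 * (3 * k * a + (j + 1)) by rw [hkj]; ring]; omega
    have e3 : k * (6 * a + 1) = 3 * k * (2 * a) + k := by ring
    have key : reeTorus ε (k * (6 * a + 1)) ≡ reeTorus (ε * reeSign (6 * a + 1)) k [ZMOD M] := by
      simp only [reeTorus, reeSign, e1, e2, hj]
      rw [e3, pow_add _ _ k, pow_add _ _ (j + 1), pow_mul (3 : ℤ) (3 * k),
        pow_mul (3 : ℤ) (3 * k)]
      calc _ ≡ (-1) ^ (2 * a) * 3 ^ k + ε * ((-1) ^ a * 3 ^ (j + 1)) + 1 [ZMOD M] := by gcongr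
        _ = _ := by
          rw [pow_mul]; push_cast; simp; ring
    exact key.dvd_iff
  · obtain ⟨a, rfl⟩ : ∃ a, q = 6 * a + 5 := ⟨q / 6, by omega⟩
    have e1 : (6 * a + 5 + 1) / 6 = a + 1 := by omega
    have e2 : k + (k * (6 * a + 5) + 1) / 2 = 3 * k * (a + 1) + (j + 1) := by
      rw [show k * (6 * a + 5) + 1 = 2 * (3 * k * a + 2 * k + (j + 1)) by rw [hkj]; ring]
      rw [Nat.mul_div_cancel_left _ (by norm_num)]; ring
    have e3 : k + k * (6 * a + 5) = 3 * k * (2 * (a + 1)) := by ring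
    have key : 3 ^ k * reeTorus ε (k * (6 * a + 5)) ≡
        reeTorus (ε * reeSign (6 * a + 5)) k [ZMOD M] := by
      simp only [reeTorus, reeSign, e1, hj]
      rw [mul_add, mul_add, mul_left_comm, ← pow_add, ← pow_add, e2, e3, pow_add,
        pow_mul (3 : ℤ) (3 * k), pow_mul (3 : ℤ) (3 * k)]
      calc _ ≡ (-1) ^ (2 * (a + 1)) + ε * ((-1) ^ (a + 1) * 3 ^ (j + 1)) + 3 ^ k * 1 [ZMOD M] := by
            gcongr
        _ = _ := by
          rw [pow_mul]; push_cast; simp; ring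
    rw [← key.dvd_iff]
    have hco : IsCoprime M (3 ^ k) :=
      (isCoprime_three_of_dvd_pow_add_one (by omega) hM).pow_right
    exact ⟨fun h => h.mul_left _, hco.dvd_of_dvd_mul_left⟩

theorem reeTorus_dvd_reeTorus_mul {k q : ℕ} (ε : ℤˣ) (hk : Odd k) (hq : q.Coprime 6) :
    reeTorus (ε * reeSign q) k ∣ reeTorus ε (k * q) :=
  (dvd_reeTorus_mul_iff ε hk (reeTorus_dvd_pow_add_one _ hk) hq).2 dvd_rfl

theorem dvd_add_one_of_dvd_sq_sub_one {R : Type*} [CommRing R] {M x : R} {p : ℕ} (hp : Odd p)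
    (h1 : M ∣ x ^ 2 - 1) (h2 : M ∣ x ^ p + 1) : M ∣ x + 1 := by
  obtain ⟨j, rfl⟩ := hp
  have h3 : M ∣ (x ^ 2) ^ j - 1 := h1.trans (by simpa using sub_dvd_pow_sub_pow (x ^ 2) 1 j)
  have : x + 1 = (x ^ (2 * j + 1) + 1) - x * ((x ^ 2) ^ j - 1) := by ring
  rw [this]
  exact dvd_sub h2 (h3.mul_left _)

theorem Int.dvd_pow_gcd_sub_one {M x : ℤ} {a b : ℕ} (ha : M ∣ x ^ a - 1) (hb : M ∣ x ^ b - 1) :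
    M ∣ x ^ a.gcd b - 1 := by
  rw [← Ideal.mem_span_singleton, ← Ideal.Quotient.eq_zero_iff_mem] at ha hb ⊢
  simp only [map_sub, map_pow, map_one, sub_eq_zero] at ha hb ⊢
  rw [← orderOf_dvd_iff_pow_eq_one] at ha hb ⊢
  exact Nat.dvd_gcd ha hb

theorem gcd_natAbs_reeTorus {k p q : ℕ} (ε : ℤˣ) (hk : Odd k) (hp : p.Coprime 6)
    (hq : q.Coprime 6) (hpq : p.Coprime q) :
    Nat.gcd (reeTorus (ε * reeSign p) (k * q)).natAbs (reeTorus (ε * reeSign q) (k * p)).natAbs =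
      (reeTorus (ε * reeSign p * reeSign q) k).natAbs := by
  have odd_of {r : ℕ} (hr : r.Coprime 6) : Odd r :=
    Nat.coprime_two_right.1 (hr.coprime_dvd_right (by norm_num))
  apply Nat.dvd_antisymm
  · set d := Nat.gcd (reeTorus (ε * reeSign p) (k * q)).natAbs
      (reeTorus (ε * reeSign q) (k * p)).natAbs
    have h1 : (d : ℤ) ∣ reeTorus (ε * reeSign p) (k * q) :=
      Int.natCast_dvd.2 (Nat.gcd_dvd_left _ _)
    have h2 : (d : ℤ) ∣ reeTorus (ε * reeSign q) (k * p) :=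
      Int.natCast_dvd.2 (Nat.gcd_dvd_right _ _)
    have h3 := h1.trans (reeTorus_dvd_pow_add_one _ (hk.mul (odd_of hq)))
    have h4 := h2.trans (reeTorus_dvd_pow_add_one _ (hk.mul (odd_of hp)))
    have sq_sub {r : ℕ} (h : (d : ℤ) ∣ 3 ^ (3 * (k * r)) + 1) :
        (d : ℤ) ∣ ((3 ^ (3 * k)) ^ 2) ^ r - 1 := by
      have : ((3 ^ (3 * k)) ^ 2 : ℤ) ^ r - 1 =
          (3 ^ (3 * (k * r)) + 1) * (3 ^ (3 * (k * r)) - 1) := by ring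
      rw [this]; exact h.mul_right _
    have h5 := Int.dvd_pow_gcd_sub_one (sq_sub h4) (sq_sub h3)
    rw [hpq, pow_one] at h5
    have h6 : (d : ℤ) ∣ 3 ^ (3 * k) + 1 :=
      dvd_add_one_of_dvd_sq_sub_one (odd_of hq) h5 (by rwa [← pow_mul, mul_assoc])
    exact Int.natCast_dvd.1 ((dvd_reeTorus_mul_iff _ hk h6 hq).1 h1)
  · refine Nat.dvd_gcd (Int.natAbs_dvd_natAbs.2 (reeTorus_dvd_reeTorus_mul _ hk hq)) ?_
    rw [mul_right_comm]
    exact Int.natAbs_dvd_natAbs.2 (reeTorus_dvd_reeTorus_mul _ hk hp)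

theorem Nat.gcd_lcm_right_distrib {a b c : ℕ} (ha : a ≠ 0) (hb : b ≠ 0) (hc : c ≠ 0) :
    Nat.gcd (Nat.lcm a b) c = Nat.lcm (Nat.gcd a c) (Nat.gcd b c) := by
  have hac : Nat.gcd a c ≠ 0 := Nat.gcd_ne_zero_left ha
  have hbc : Nat.gcd b c ≠ 0 := Nat.gcd_ne_zero_left hb
  apply Nat.eq_of_factorization_eq (Nat.gcd_ne_zero_right hc) (Nat.lcm_ne_zero hac hbc)
  intro p
  rw [Nat.factorization_gcd (Nat.lcm_ne_zero ha hb) hc, Nat.factorization_lcm ha hb,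
    Nat.factorization_lcm hac hbc, Nat.factorization_gcd ha hc, Nat.factorization_gcd hb hc]
  exact inf_sup_right (α := ℕ) _ _ _

theorem Finset.gcd_lcm_distrib {ι : Type*} (S : Finset ι) (f : ι → ℕ) (c : ℕ)
    (hf : ∀ i ∈ S, f i ≠ 0) (hc : c ≠ 0) :
    Nat.gcd (S.lcm f) c = S.lcm fun i => Nat.gcd (f i) c := by
  classical
  induction S using Finset.induction_on with
  | empty => simp
  | insert i S hi ih =>
    have hS : ∀ j ∈ S, f j ≠ 0 := fun j hj => hf j (Finset.mem_insert_of_mem hj)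
    have h0 : S.lcm f ≠ 0 := by
      rw [Ne, Finset.lcm_eq_zero_iff]
      rintro ⟨j, hj, hj0⟩
      exact hS j hj hj0
    rw [Finset.lcm_insert, Finset.lcm_insert, ← ih hS]
    exact Nat.gcd_lcm_right_distrib (hf i (Finset.mem_insert_self _ _)) h0 hc

/-- The least common multiple of the divisors of `reeTorus ε n` attached to the maximal proper
divisors `n / p` of `n`, for `p ∈ S`. -/
def reeLcm (S : Finset ℕ) (ε : ℤˣ) (n : ℕ) : ℕ :=
  S.lcm fun p => (reeTorus (ε * reeSign p) (n / p)).natAbs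

theorem coprime_six_of_prime {p : ℕ} (hp : p.Prime) (h5 : 5 ≤ p) : p.Coprime 6 := by
  rw [hp.coprime_iff_not_dvd]
  intro h
  have := Nat.le_of_dvd (by norm_num) h
  interval_cases p <;> revert hp h <;> decide

theorem odd_div_of_dvd {n p : ℕ} (hn : Odd n) (h : p ∣ n) : Odd (n / p) :=
  hn.of_dvd_nat (Nat.div_dvd_of_dvd h)

theorem reeLcm_dvd {S : Finset ℕ} (hS : ∀ p ∈ S, p.Prime ∧ 5 ≤ p) (ε : ℤˣ) {n : ℕ} (hn : Odd n)
    (hSn : ∀ p ∈ S, p ∣ n) : reeLcm S ε n ∣ (reeTorus ε n).natAbs := by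
  refine Finset.lcm_dvd fun p hp => Int.natAbs_dvd_natAbs.2 ?_
  have := reeTorus_dvd_reeTorus_mul ε (odd_div_of_dvd hn (hSn p hp))
    (coprime_six_of_prime (hS p hp).1 (hS p hp).2)
  rwa [Nat.div_mul_cancel (hSn p hp)] at this

theorem gcd_reeLcm {S : Finset ℕ} (hS : ∀ p ∈ S, p.Prime ∧ 5 ≤ p) {q : ℕ} (hq : q.Prime)
    (hq5 : 5 ≤ q) (hqS : q ∉ S) (ε : ℤˣ) {n : ℕ} (hn : Odd n) (hSn : ∀ p ∈ S, p ∣ n)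
    (hqn : q ∣ n) :
    Nat.gcd (reeLcm S ε n) (reeTorus (ε * reeSign q) (n / q)).natAbs =
      reeLcm S (ε * reeSign q) (n / q) := by
  unfold reeLcm
  rw [Finset.gcd_lcm_distrib]
  · refine Finset.lcm_congr rfl fun p hp => ?_
    obtain ⟨hpp, hp5⟩ := hS p hp
    have hpq : p.Coprime q := (Nat.coprime_primes hpp hq).2 fun h => hqS (h ▸ hp)
    obtain ⟨m, rfl⟩ := hpq.mul_dvd_of_dvd_of_dvd (hSn p hp) hqn
    have e1 : p * q * m / p = m * q := by
      rw [mul_assoc, Nat.mul_div_cancel_left _ hpp.pos, mul_comm]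
    have e2 : p * q * m / q = m * p := by
      rw [mul_comm p q, mul_assoc, Nat.mul_div_cancel_left _ hq.pos, mul_comm]
    rw [e1, e2, Nat.mul_div_cancel _ hpp.pos,
      gcd_natAbs_reeTorus ε (Nat.odd_mul.1 hn).2 (coprime_six_of_prime hpp hp5)
        (coprime_six_of_prime hq hq5) hpq, mul_right_comm]
  · exact fun p hp => Int.natAbs_ne_zero.2 (reeTorus_pos _ (odd_div_of_dvd hn (hSn p hp))).ne'
  · exact Int.natAbs_ne_zero.2 (reeTorus_pos _ (odd_div_of_dvd hn hqn)).ne'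

/-- The cofactor of `reeLcm S ε (m * ∏ p ∈ S, p)` is `3 ^ (m * ∏ p ∈ S, (p - 1))`, up to a factor
of at most `3 ^ 2 ^ #S`. -/
theorem exists_mul_reeLcm_eq {S : Finset ℕ} (hS : ∀ p ∈ S, p.Prime ∧ 5 ≤ p) (m : ℕ) (ε : ℤˣ)
    (hm : Odd m) : ∃ R : ℕ, R * reeLcm S ε (m * ∏ p ∈ S, p) =
        (reeTorus ε (m * ∏ p ∈ S, p)).natAbs ∧
      3 ^ (m * ∏ p ∈ S, (p - 1)) ≤ R * 3 ^ 2 ^ S.card ∧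
      R ≤ 3 ^ (m * (∏ p ∈ S, (p - 1)) + 2 ^ S.card) := by
  induction S using Finset.induction_on generalizing m ε with
  | empty =>
    refine ⟨(reeTorus ε m).natAbs, by simp [reeLcm], ?_, ?_⟩
    · zify
      rw [abs_of_pos (reeTorus_pos ε hm)]
      simpa [mul_comm] using pow_le_three_mul_reeTorus ε hm
    · zify
      rw [abs_of_pos (reeTorus_pos ε hm)]
      simpa using reeTorus_le_pow ε hm
  | insert q S hqS ih =>
    obtain ⟨hq, hq5⟩ := hS q (Finset.mem_insert_self _ _)
    have hS' : ∀ p ∈ S, p.Prime ∧ 5 ≤ p := fun p hp => hS p (Finset.mem_insert_of_mem hp)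
    have odd_of {p : ℕ} (h : p.Prime ∧ 5 ≤ p) : Odd p := h.1.odd_of_ne_two (by omega)
    have hqo : Odd q := odd_of ⟨hq, hq5⟩
    have hPo : Odd (∏ p ∈ S, p) := Finset.prod_induction _ Odd (fun _ _ => Odd.mul) odd_one
      fun p hp => odd_of (hS' p hp)
    obtain ⟨R₁, hR₁, hl₁, hu₁⟩ := ih hS' (m * q) ε (hm.mul hqo)
    obtain ⟨R₂, hR₂, hl₂, hu₂⟩ := ih hS' m (ε * reeSign q) hm
    rw [Finset.prod_insert hqS, Finset.prod_insert hqS, Finset.card_insert_of_notMem hqS]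
    set P := ∏ p ∈ S, p
    set N := ∏ p ∈ S, (p - 1)
    have hn : m * (q * P) = m * q * P := (mul_assoc _ _ _).symm
    have hno : Odd (m * q * P) := (hm.mul hqo).mul hPo
    have hdiv : m * q * P / q = m * P := by
      rw [mul_right_comm, Nat.mul_div_cancel _ hq.pos]
    have hqn : q ∣ m * q * P := (dvd_mul_left q m).mul_right P
    have hSn : ∀ p ∈ S, p ∣ m * q * P := fun p hp => (Finset.dvd_prod_of_mem _ hp).mul_left _
    have hgcd := gcd_reeLcm hS' hq hq5 hqS ε hno hSn hqn
    obtain ⟨R, hR⟩ := reeLcm_dvd hS ε hno fun p hp => by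
      rcases Finset.mem_insert.1 hp with rfl | hp
      exacts [hqn, hSn p hp]
    rw [hdiv] at hgcd
    have hL' : reeLcm (insert q S) ε (m * q * P) =
        Nat.lcm (reeTorus (ε * reeSign q) (m * P)).natAbs (reeLcm S ε (m * q * P)) := by
      rw [reeLcm, Finset.lcm_insert, hdiv]; rfl
    have hTpos : (reeTorus ε (m * q * P)).natAbs ≠ 0 := Int.natAbs_ne_zero.2 (reeTorus_pos _ hno).ne'
    have hTpos' : (reeTorus (ε * reeSign q) (m * P)).natAbs ≠ 0 :=
      Int.natAbs_ne_zero.2 (reeTorus_pos _ (hm.mul hPo)).ne'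
    have hgl := Nat.gcd_mul_lcm (reeTorus (ε * reeSign q) (m * P)).natAbs (reeLcm S ε (m * q * P))
    rw [Nat.gcd_comm, hgcd, ← hL'] at hgl
    have hRR : R * R₂ = R₁ := by
      have h1 : reeLcm S ε (m * q * P) ≠ 0 := right_ne_zero_of_mul (hR₁ ▸ hTpos)
      have h2 : reeLcm S (ε * reeSign q) (m * P) ≠ 0 := right_ne_zero_of_mul (hR₂ ▸ hTpos')
      apply mul_right_cancel₀ (mul_ne_zero h1 h2)
      calc R * R₂ * (reeLcm S ε (m * q * P) * reeLcm S (ε * reeSign q) (m * P))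
          = R * ((R₂ * reeLcm S (ε * reeSign q) (m * P)) * reeLcm S ε (m * q * P)) := by ring
        _ = R * (reeLcm S (ε * reeSign q) (m * P) * reeLcm (insert q S) ε (m * q * P)) := by
            rw [hR₂, hgl]
        _ = (reeLcm (insert q S) ε (m * q * P) * R) * reeLcm S (ε * reeSign q) (m * P) := by ring
        _ = R₁ * (reeLcm S ε (m * q * P) * reeLcm S (ε * reeSign q) (m * P)) := by
            rw [← hR, ← hR₁]; ring
    have hexp : m * q * N = m * N + m * ((q - 1) * N) := by
      obtain ⟨r, rfl⟩ : ∃ r, q = r + 1 := ⟨q - 1, by omega⟩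
      rw [Nat.add_sub_cancel]; ring
    set e := 2 ^ S.card
    have he : 2 ^ (S.card + 1) = e + e := by rw [pow_succ]; ring
    rw [hn, he]
    refine ⟨R, by rw [hR, mul_comm], ?_, ?_⟩
    · refine Nat.le_of_mul_le_mul_left (c := 3 ^ (m * N)) ?_ (by positivity)
      calc 3 ^ (m * N) * 3 ^ (m * ((q - 1) * N)) = 3 ^ (m * q * N) := by rw [hexp, pow_add]
        _ ≤ R * R₂ * 3 ^ e := by rw [hRR]; exact hl₁
        _ ≤ R * 3 ^ (m * N + e) * 3 ^ e := by gcongr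
        _ = 3 ^ (m * N) * (R * 3 ^ (e + e)) := by ring
    · refine Nat.le_of_mul_le_mul_left (c := 3 ^ (m * N)) ?_ (by positivity)
      calc 3 ^ (m * N) * R ≤ R₂ * 3 ^ e * R := by gcongr
        _ = R * R₂ * 3 ^ e := by ring
        _ ≤ 3 ^ (m * q * N + e) * 3 ^ e := by rw [hRR]; gcongr
        _ = 3 ^ (m * N) * 3 ^ (m * ((q - 1) * N) + (e + e)) := by rw [hexp]; ring

theorem mul_sq_lt_pow {A B q : ℕ} (hq : 5 ≤ q) (hA : 3 ≤ A) (hAB : A ≤ B) :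
    q * A ^ 2 < B ^ (q - 1) := by
  obtain ⟨r, rfl⟩ : ∃ r, q = r + 5 := ⟨q - 5, by omega⟩
  have h : ∀ r : ℕ, r + 5 < 3 ^ (r + 2) := fun r => by
    induction r with
    | zero => norm_num
    | succ r ih => rw [pow_succ]; omega
  calc (r + 5) * A ^ 2 < 3 ^ (r + 2) * A ^ 2 := by
        have : 0 < A ^ 2 := by positivity
        have := h r
        gcongr
    _ ≤ B ^ (r + 2) * B ^ 2 := by gcongr; omega
    _ = B ^ (r + 5 - 1) := by rw [← pow_add]; congr 1

theorem prod_mul_pow_insert_lt {S : Finset ℕ} {q m : ℕ} (hq : 5 ≤ q) (hqS : q ∉ S)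
    (ih : (∏ p ∈ S, p) * 3 ^ 2 ^ S.card ≤ 3 ^ (m * ∏ p ∈ S, (p - 1)))
    (hS : 0 < ∏ p ∈ S, p) :
    (∏ p ∈ insert q S, p) * 3 ^ 2 ^ (insert q S).card <
      3 ^ (m * ∏ p ∈ insert q S, (p - 1)) := by
  rw [Finset.prod_insert hqS, Finset.prod_insert hqS, Finset.card_insert_of_notMem hqS]
  have h3 : 3 ≤ (∏ p ∈ S, p) * 3 ^ 2 ^ S.card :=
    (Nat.le_self_pow (by positivity) 3).trans (Nat.le_mul_of_pos_left _ hS)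
  have h := mul_sq_lt_pow hq h3 ih
  rw [← pow_mul, mul_pow, ← pow_mul] at h
  calc _ ≤ q * ((∏ p ∈ S, p) ^ 2 * 3 ^ (2 ^ S.card * 2)) := by
        rw [pow_succ, mul_assoc]
        gcongr
        exact Nat.le_self_pow (by norm_num) _
    _ < _ := h
    _ = _ := by congr 1; ring

theorem prod_mul_pow_le {S : Finset ℕ} (hS : ∀ p ∈ S, 5 ≤ p) {m : ℕ} (hm : 1 ≤ m) :
    (∏ p ∈ S, p) * 3 ^ 2 ^ S.card ≤ 3 ^ (m * ∏ p ∈ S, (p - 1)) := by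
  induction S using Finset.induction_on with
  | empty => simpa using Nat.le_self_pow (by omega) 3
  | insert q S hqS ih =>
    have hS' : ∀ p ∈ S, 5 ≤ p := fun p hp => hS p (Finset.mem_insert_of_mem hp)
    exact (prod_mul_pow_insert_lt (hS q (Finset.mem_insert_self _ _)) hqS (ih hS')
      (Finset.prod_pos fun p hp => by have := hS' p hp; omega)).le

theorem prod_mul_pow_lt {S : Finset ℕ} (hS : ∀ p ∈ S, 5 ≤ p) {m : ℕ} (hm : 1 ≤ m)
    (h : 1 < m * ∏ p ∈ S, p) :
    (∏ p ∈ S, p) * 3 ^ 2 ^ S.card < 3 ^ (m * ∏ p ∈ S, (p - 1)) := by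
  induction S using Finset.induction_on with
  | empty =>
    have : 3 ^ 1 < 3 ^ m := Nat.pow_lt_pow_right (by norm_num) (by simpa using h)
    simpa using this
  | insert q S hqS _ =>
    have hS' : ∀ p ∈ S, 5 ≤ p := fun p hp => hS p (Finset.mem_insert_of_mem hp)
    exact prod_mul_pow_insert_lt (hS q (Finset.mem_insert_self _ _)) hqS (prod_mul_pow_le hS' hm)
      (Finset.prod_pos fun p hp => by have := hS' p hp; omega)

/-- If `3` does not have order `6 * n` modulo a prime divisor of `reeTorus ε n`, then this prime
already divides one of the divisors attached to the maximal proper divisors of `n`. -/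
theorem exists_prime_dvd_reeTorus_div {n ℓ i : ℕ} {ε : ℤˣ} (hn : Odd n) (hℓ : ℓ.Prime)
    (hdvd : (ℓ : ℤ) ∣ reeTorus ε n) (hi : 1 ≤ i) (hin : i < 6 * n) (hℓi : (ℓ : ℤ) ∣ 3 ^ i - 1) :
    ∃ p, p.Prime ∧ 5 ≤ p ∧ p ∣ n ∧ (ℓ : ℤ) ∣ reeTorus (ε * reeSign p) (n / p) := by
  have h3 : (ℓ : ℤ) ∣ 3 ^ (3 * n) + 1 := hdvd.trans (reeTorus_dvd_pow_add_one ε hn)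
  have h6 : (ℓ : ℤ) ∣ 3 ^ (6 * n) - 1 := by
    rw [show (3 : ℤ) ^ (6 * n) - 1 = (3 ^ (3 * n) + 1) * (3 ^ (3 * n) - 1) by ring]
    exact h3.mul_right _
  have hn0 : 0 < n := hn.pos
  have hcop : IsCoprime (ℓ : ℤ) 3 := isCoprime_three_of_dvd_pow_add_one (by omega) h3
  have hunit : ¬ IsUnit (ℓ : ℤ) := (Nat.prime_iff_prime_int.1 hℓ).not_isUnit
  have hℓ2 : ¬ (ℓ : ℤ) ∣ 2 := fun h => by
    have h2 : ℓ ∣ 2 := by exact_mod_cast h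
    obtain rfl := (Nat.prime_dvd_prime_iff_eq hℓ Nat.prime_two).1 h2
    exact (Int.not_even_iff_odd.2 (odd_reeTorus ε n)) (even_iff_two_dvd.2 hdvd)
  have hnot_three : ¬ (ℓ : ℤ) ∣ 3 ^ (3 * n) - 1 := fun h => hℓ2 (by
    have := dvd_sub h3 h
    ring_nf at this
    exact this)
  have hnot_two : ¬ (ℓ : ℤ) ∣ 3 ^ (2 * n) - 1 := fun h => hunit (by
    have h1 : (ℓ : ℤ) ∣ 3 ^ (2 * n) - 3 ^ n + 1 := by
      rw [← reeTorus_mul_neg ε hn]; exact hdvd.mul_right _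
    refine hcop.isUnit_of_dvd' dvd_rfl ?_
    have e : (3 : ℤ) = (3 ^ (2 * n) - 3 ^ n + 1) * (3 ^ n + 2) - (3 ^ (2 * n) - 1) * (3 ^ n + 1)
        := by ring
    rw [e]
    exact dvd_sub (h1.mul_right _) (h.mul_right _))
  set d := Nat.gcd (6 * n) i
  have hd : (ℓ : ℤ) ∣ 3 ^ d - 1 := Int.dvd_pow_gcd_sub_one h6 hℓi
  have of_dvd {a : ℕ} (h : d ∣ a) : (ℓ : ℤ) ∣ 3 ^ a - 1 := by
    obtain ⟨c, rfl⟩ := h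
    rw [pow_mul]
    exact hd.trans (by simpa using sub_dvd_pow_sub_pow ((3 : ℤ) ^ d) 1 c)
  obtain ⟨e, he⟩ : d ∣ 6 * n := Nat.gcd_dvd_left _ _
  have he1 : e ≠ 1 := by
    rintro rfl
    have : d ≤ i := Nat.le_of_dvd hi (Nat.gcd_dvd_right _ _)
    omega
  obtain ⟨p, hp, c, rfl⟩ := Nat.exists_prime_and_dvd he1
  have hp2 : p ≠ 2 := by
    rintro rfl
    exact hnot_three (of_dvd ⟨c, by linarith⟩)
  have hp3 : p ≠ 3 := by
    rintro rfl
    exact hnot_two (of_dvd ⟨c, by linarith⟩)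
  have hp5 : 5 ≤ p := by
    have := hp.two_le
    by_contra! h
    have : p = 4 := by omega
    subst this
    revert hp; decide
  have hcop6 := coprime_six_of_prime hp hp5
  have hpn : p ∣ n := hcop6.dvd_of_dvd_mul_left ⟨d * c, by rw [he]; ring⟩
  obtain ⟨k, rfl⟩ := hpn
  refine ⟨p, hp, hp5, dvd_mul_right _ _, ?_⟩
  rw [Nat.mul_div_cancel_left _ hp.pos]
  have hk : Odd k := (Nat.odd_mul.1 hn).2
  rw [mul_comm p k] at hdvd h3
  refine (dvd_reeTorus_mul_iff ε hk ?_ hcop6).1 hdvd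
  refine dvd_add_one_of_dvd_sq_sub_one (hp.odd_of_ne_two hp2) ?_ (by rwa [← pow_mul, mul_assoc])
  rw [← pow_mul]
  refine of_dvd ⟨c, Nat.eq_of_mul_eq_mul_left hp.pos ?_⟩
  linarith

/-- The lifting-the-exponent lemma, as a bound on the cofactors of `x + 1` in `x ^ p + 1`. -/
theorem eq_and_not_sq_dvd_of_mul_dvd_pow_add_one {x p ℓ Q : ℕ} (hp : p.Prime) (hp2 : p ≠ 2)
    (hℓ : ℓ.Prime) (hℓ2 : ℓ ≠ 2) (hx : ℓ ∣ x + 1) (hQ : (x + 1) * Q ∣ x ^ p + 1) (hℓQ : ℓ ∣ Q) :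
    ℓ = p ∧ ¬ ℓ * ℓ ∣ Q := by
  have := Fact.mk hℓ
  have := Fact.mk hp
  have hℓx : ¬ ℓ ∣ x := fun h => hℓ.one_lt.ne' (Nat.dvd_one.1 ((Nat.dvd_add_right h).1 hx))
  have hlte := padicValNat.pow_add_pow (y := 1) (hℓ.odd_of_ne_two hℓ2) hx hℓx
    (hp.odd_of_ne_two hp2)
  rw [one_pow] at hlte
  have hQ0 : Q ≠ 0 := by
    rintro rfl
    simp at hQ
  have hle : padicValNat ℓ Q ≤ padicValNat ℓ p := by
    have h1 := (padicValNat_dvd_iff_le (p := ℓ) (Nat.succ_ne_zero (x ^ p))).1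
      ((pow_padicValNat_dvd (p := ℓ) (n := (x + 1) * Q)).trans hQ)
    rw [padicValNat.mul (Nat.succ_ne_zero x) hQ0] at h1
    simp only [Nat.succ_eq_add_one] at h1
    omega
  have h1 : 1 ≤ padicValNat ℓ Q := one_le_padicValNat_of_dvd hQ0 hℓQ
  have hℓp : ℓ = p := by
    by_contra h
    rw [padicValNat_primes h] at hle
    omega
  refine ⟨hℓp, fun h => ?_⟩
  rw [← sq, padicValNat_dvd_iff_le hQ0] at h
  subst hℓp
  rw [padicValNat.self hℓ.one_lt] at hle
  omega

theorem three_pow_add_one_mul_dvd {k p Q : ℕ} {ε : ℤˣ} (hk : Odd k) (hp : Odd p)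
    (hp6 : p.Coprime 6)
    (hQ : reeTorus (ε * reeSign p) k * Q = reeTorus ε (k * p)) :
    (3 ^ (3 * k) + 1) * Q ∣ (3 ^ (3 * k)) ^ p + 1 := by
  zify
  rw [← reeTorus_mul_cofactor (ε * reeSign p) hk, ← pow_mul, mul_assoc 3,
    ← reeTorus_mul_cofactor ε (hk.mul hp), mul_right_comm, hQ]
  refine mul_dvd_mul_left _ (mul_dvd_mul ?_ ?_)
  · rw [pow_mul]
    simpa using Odd.add_dvd_pow_add_pow ((3 : ℤ) ^ k) 1 hp
  · have := reeTorus_dvd_reeTorus_mul (-ε) hk hp6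
    rwa [neg_mul] at this

theorem ppd_divides_t_minus_ree (n : ℕ) (hodd : Odd n) (hn : 3 ≤ n) :
    ∃ ℓ : ℕ, ℓ.Prime ∧ (ℓ : ℤ) ∣ 3 ^ (6 * n) - 1 ∧
      (∀ i : ℕ, 1 ≤ i → i < 6 * n → ¬ (ℓ : ℤ) ∣ 3 ^ i - 1) ∧
      (ℓ : ℤ) ∣ (3 : ℤ) ^ n - 3 ^ ((n + 1) / 2) + 1 := by
  have hT : (3 : ℤ) ^ n - 3 ^ ((n + 1) / 2) + 1 = reeTorus (-1) n := by
    simp [reeTorus, sub_eq_add_neg]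
  rw [hT]
  by_contra! hcon
  have nonprim : ∀ ℓ : ℕ, ℓ.Prime → (ℓ : ℤ) ∣ reeTorus (-1) n →
      ∃ p, p.Prime ∧ 5 ≤ p ∧ p ∣ n ∧ (ℓ : ℤ) ∣ reeTorus (-1 * reeSign p) (n / p) := by
    intro ℓ hℓ hdvd
    by_contra hno
    refine hcon ℓ hℓ ?_ (fun i hi hin h => hno
      (exists_prime_dvd_reeTorus_div hodd hℓ hdvd hi hin h)) hdvd
    rw [show (3 : ℤ) ^ (6 * n) - 1 = (3 ^ (3 * n) + 1) * (3 ^ (3 * n) - 1) by ring]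
    exact (hdvd.trans (reeTorus_dvd_pow_add_one _ hodd)).mul_right _
  set S := n.primeFactors.filter (5 ≤ ·) with hSdef
  have memS {p : ℕ} : p ∈ S ↔ p.Prime ∧ 5 ≤ p ∧ p ∣ n := by
    simp only [hSdef, Finset.mem_filter, Nat.mem_primeFactors]
    have : n ≠ 0 := by omega
    tauto
  have hS : ∀ p ∈ S, p.Prime ∧ 5 ≤ p := fun p hp => ⟨(memS.1 hp).1, (memS.1 hp).2.1⟩
  obtain ⟨m, hm⟩ : (∏ p ∈ S, p) ∣ n :=
    (Finset.prod_dvd_prod_of_subset _ _ _ (Finset.filter_subset _ _)).trans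
      (Nat.prod_primeFactors_dvd n)
  rw [mul_comm] at hm
  have hmo : Odd m := (Nat.odd_mul.1 (hm ▸ hodd)).1
  obtain ⟨R, hR, hlow, -⟩ := exists_mul_reeLcm_eq hS m (-1) hmo
  rw [← hm] at hR
  have key : ∀ ℓ : ℕ, ℓ.Prime → ℓ ∣ R → ℓ ∈ S ∧ ¬ ℓ * ℓ ∣ R := by
    intro ℓ hℓ hℓR
    have hℓT : (ℓ : ℤ) ∣ reeTorus (-1) n :=
      Int.natCast_dvd.2 (hR ▸ hℓR.mul_right _)
    obtain ⟨p, hp, hp5, hpn, hℓp⟩ := nonprim ℓ hℓ hℓT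
    have hk := odd_div_of_dvd hodd hpn
    have hpS : p ∈ S := memS.2 ⟨hp, hp5, hpn⟩
    have hpo : Odd p := hp.odd_of_ne_two (by omega)
    obtain ⟨c, hc⟩ : (reeTorus (-1 * reeSign p) (n / p)).natAbs ∣ reeLcm S (-1) n :=
      Finset.dvd_lcm (f := fun p => (reeTorus (-1 * reeSign p) (n / p)).natAbs) hpS
    have hQ : reeTorus (-1 * reeSign p) (n / p) * (R * c : ℕ) = reeTorus (-1) (n / p * p) := by
      rw [Nat.div_mul_cancel hpn]
      rw [hc] at hR
      zify at hR
      rw [abs_of_pos (reeTorus_pos _ hk), abs_of_pos (reeTorus_pos _ hodd)] at hR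
      rw [← hR]; push_cast; ring
    have hdvd := three_pow_add_one_mul_dvd hk hpo (coprime_six_of_prime hp hp5) hQ
    have hx : ℓ ∣ 3 ^ (3 * (n / p)) + 1 := by
      zify
      exact hℓp.trans (reeTorus_dvd_pow_add_one _ hk)
    have hℓ2 : ℓ ≠ 2 := by
      rintro rfl
      exact (Int.not_even_iff_odd.2 (odd_reeTorus _ _)) (even_iff_two_dvd.2 hℓT)
    obtain ⟨rfl, hsq⟩ := eq_and_not_sq_dvd_of_mul_dvd_pow_add_one hp (by omega) hℓ hℓ2 hx hdvd
      (hℓR.mul_right c)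
    exact ⟨hpS, fun h => hsq (h.mul_right c)⟩
  have hsf : Squarefree R := Nat.squarefree_iff_prime_squarefree.2 fun ℓ hℓ h =>
    (key ℓ hℓ ((dvd_mul_right ℓ ℓ).trans h)).2 h
  have hRle : R ≤ ∏ p ∈ S, p := by
    rw [← Nat.prod_primeFactors_of_squarefree hsf]
    refine Nat.le_of_dvd (Finset.prod_pos fun p hp => (hS p hp).1.pos)
      (Finset.prod_dvd_prod_of_subset _ _ _ fun p hp => ?_)
    exact (key p (Nat.prime_of_mem_primeFactors hp) (Nat.dvd_of_mem_primeFactors hp)).1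
  have hlt := prod_mul_pow_lt (fun p hp => (hS p hp).2) hmo.pos
    (show 1 < m * ∏ p ∈ S, p by omega)
  have : R * 3 ^ 2 ^ S.card ≤ (∏ p ∈ S, p) * 3 ^ 2 ^ S.card := Nat.mul_le_mul_right _ hRle
  omega
end

section
/- Let p and ρ be distinct primes. Suppose a cyclic group A of order p acts faithfully on a finite ρ-group G, and let χ be an A-invariant faithful irreducible complex character of G of degree ρ^a. If n is the multiplicative order of ρ modulo p, then n ≤ 2a. -/
open CategoryTheory

namespace Representation

variable {G V : Type*} [Group G] [AddCommGroup V] [Module ℂ V]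

theorem nontrivial_of_isIrreducible (ρ : Representation ℂ G V) [hρ : ρ.IsIrreducible] :
    Nontrivial V := by
  by_contra h
  rw [not_nontrivial_iff_subsingleton] at h
  obtain ⟨x, y, hxy⟩ := hρ.toNontrivial
  exact hxy (Subrepresentation.toSubmodule_injective (Subsingleton.elim _ _))

variable [FiniteDimensional ℂ V]

theorem isIntegral_character [Finite G] (ρ : Representation ℂ G V) (g : G) :
    IsIntegral ℤ (ρ.character g) := by
  rw [character, Module.End.trace_eq_sum_roots_charpoly_of_splits (IsAlgClosed.splits _)]
  refine IsIntegral.multiset_sum fun μ hμ ↦ ?_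
  have hμ' : Module.End.HasEigenvalue (ρ g) μ := by
    rw [Module.End.hasEigenvalue_iff_isRoot_charpoly]
    exact Polynomial.isRoot_of_mem_roots hμ
  obtain ⟨v, hv⟩ := hμ'.exists_hasEigenvector
  have hpow : μ ^ Nat.card G • v = v := by
    rw [← hv.pow_apply, ← map_pow, pow_card_eq_one', map_one, Module.End.one_apply]
  have h1 : μ ^ Nat.card G = 1 := by
    have := sub_eq_zero.mpr hpow
    nth_rw 2 [← one_smul ℂ v] at this
    rw [← sub_smul] at this
    exact sub_eq_zero.mp ((smul_eq_zero.mp this).resolve_right hv.2)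
  exact IsIntegral.of_pow Nat.card_pos (h1 ▸ isIntegral_one)

/-- The Schur lemma in scalar form. -/
theorem exists_eq_smul_one_of_commute (ρ : Representation ℂ G V) [ρ.IsIrreducible]
    (f : V →ₗ[ℂ] V) (hf : ∀ g, f * ρ g = ρ g * f) :
    ∃ c : ℂ, f = c • 1 ∧ (Module.finrank ℂ V : ℂ) * c = LinearMap.trace ℂ V f := by
  let F : IntertwiningMap ρ ρ := ⟨f, fun g ↦ hf g⟩
  obtain ⟨c, hc⟩ :=
    (IsIrreducible.algebraMap_intertwiningMap_bijective_of_isAlgClosed (ρ := ρ)).2 F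
  have hfc : f = c • 1 := by
    have := congrArg IntertwiningMap.toLinearMap hc
    exact this.symm
  refine ⟨c, hfc, ?_⟩
  rw [hfc, map_smul, LinearMap.trace_one, smul_eq_mul, mul_comm]

theorem character_restrict_add_restrict (ρ : Representation ℂ G V) {W₁ W₂ : Subrepresentation ρ}
    (h : IsCompl W₁ W₂) :
    ρ.character = W₁.toRepresentation.character + W₂.toRepresentation.character := by
  have hc : IsCompl W₁.toSubmodule W₂.toSubmodule := by
    constructor
    · rw [disjoint_iff]; exact congrArg Subrepresentation.toSubmodule (disjoint_iff.mp h.1)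
    · rw [codisjoint_iff]; exact congrArg Subrepresentation.toSubmodule (codisjoint_iff.mp h.2)
  ext g
  have key : ρ g = (Submodule.prodEquivOfIsCompl _ _ hc).conj
      ((W₁.toRepresentation g).prodMap (W₂.toRepresentation g)) := by
    rw [LinearEquiv.conj_apply, LinearEquiv.eq_comp_toLinearMap_symm]
    ext x <;> simp [Subrepresentation.toRepresentation]
  simp only [character, Pi.add_apply]
  rw [key, LinearMap.trace_conj', LinearMap.trace_prodMap']

end Representation

theorem Int.dvd_of_eq_mul_isIntegral {m n : ℤ} {z : ℂ} (h : (n : ℂ) = m * z)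
    (hz : IsIntegral ℤ z) : m ∣ n := by
  rcases eq_or_ne m 0 with rfl | hm
  · have : n = 0 := by simpa using h
    simp [this]
  have hm' : (m : ℂ) ≠ 0 := Int.cast_ne_zero.mpr hm
  have hzq : z = algebraMap ℚ ℂ (n / m) := by
    rw [map_div₀, map_intCast, map_intCast, h, mul_div_cancel_left₀ _ hm']
  rw [hzq, isIntegral_algebraMap_iff (algebraMap ℚ ℂ).injective,
    IsIntegrallyClosed.isIntegral_iff] at hz
  obtain ⟨k, hk⟩ := hz
  refine ⟨k, ?_⟩
  rw [eq_intCast, eq_div_iff (Int.cast_ne_zero.mpr hm)] at hk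
  rw [mul_comm]
  exact_mod_cast hk.symm

/-- A function on `G` is an irreducible character if it is the character of some irreducible
finite-dimensional complex representation. -/
def IsIrreducibleCharacter {G : Type*} [Group G] (β : G → ℂ) : Prop :=
  ∃ (W : Type) (_ : AddCommGroup W) (_ : Module ℂ W) (_ : FiniteDimensional ℂ W)
    (σ : Representation ℂ G W), σ.IsIrreducible ∧ σ.character = β

section Characters

variable {G : Type*} [Group G]

theorem Representation.exists_multiset_sum_eq_character [Finite G] {V : Type} [AddCommGroup V]
    [Module ℂ V] [FiniteDimensional ℂ V] (ρ : Representation ℂ G V) :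
    ∃ s : Multiset (G → ℂ), (∀ β ∈ s, IsIrreducibleCharacter β) ∧ s.sum = ρ.character := by
  induction hn : Module.finrank ℂ V using Nat.strong_induction_on generalizing V with
  | _ n ih =>
    by_cases hirr : ρ.IsIrreducible
    · exact ⟨{ρ.character}, by
        simpa using ⟨V, _, _, inferInstance, ρ, hirr, rfl⟩, Multiset.sum_singleton _⟩
    rcases subsingleton_or_nontrivial V with hV | hV
    · refine ⟨0, by simp, ?_⟩
      ext g
      have : ρ g = 0 := Subsingleton.elim _ _
      simp [Representation.character, this]
    have hnt : Nontrivial (Subrepresentation ρ) := by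
      refine ⟨⊥, ⊤, fun h ↦ ?_⟩
      exact bot_ne_top (congrArg Subrepresentation.toSubmodule h)
    obtain ⟨W, hWb, hWt⟩ : ∃ W : Subrepresentation ρ, W ≠ ⊥ ∧ W ≠ ⊤ := by
      by_contra! h
      exact hirr { eq_bot_or_eq_top := fun W ↦ or_iff_not_imp_left.mpr (h W) }
    have hss : ρ.IsSemisimpleRepresentation := by
      rw [Representation.isSemisimpleRepresentation_iff_isSemisimpleModule_asModule]
      have : NeZero (Nat.card G : ℂ) := ⟨Nat.cast_ne_zero.mpr Nat.card_pos.ne'⟩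
      infer_instance
    obtain ⟨W', hW'⟩ := hss.exists_isCompl W
    have hW't : W' ≠ ⊤ := by
      rintro rfl
      exact hWb (by simpa using hW'.1)
    have hlt : ∀ U : Subrepresentation ρ, U ≠ ⊤ → Module.finrank ℂ U.toSubmodule < n := by
      intro U hU
      rw [← hn]
      exact Submodule.finrank_lt fun h ↦ hU (Subrepresentation.toSubmodule_injective h)
    obtain ⟨s, hs, hs'⟩ := ih _ (hlt W hWt) W.toRepresentation rfl
    obtain ⟨t, ht, ht'⟩ := ih _ (hlt W' hW't) W'.toRepresentation rfl
    refine ⟨s + t, fun β hβ ↦ (Multiset.mem_add.mp hβ).elim (hs β) (ht β), ?_⟩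
    rw [Multiset.sum_add, hs', ht', ρ.character_restrict_add_restrict hW']

namespace IsIrreducibleCharacter

variable {β γ : G → ℂ}

theorem isIntegral [Finite G] (hβ : IsIrreducibleCharacter β) (g : G) : IsIntegral ℤ (β g) := by
  obtain ⟨W, _, _, _, σ, -, rfl⟩ := hβ
  exact σ.isIntegral_character g

theorem exists_natCast_eq_one (hβ : IsIrreducibleCharacter β) : ∃ d : ℕ, 0 < d ∧ β 1 = d := by
  obtain ⟨W, _, _, _, σ, hσ, rfl⟩ := hβ
  have : Nontrivial W := σ.nontrivial_of_isIrreducible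
  exact ⟨_, Module.finrank_pos (R := ℂ) (M := W), σ.char_one⟩

variable [Fintype G]

open scoped Classical in
theorem sum_mul_inv (hβ : IsIrreducibleCharacter β) (hγ : IsIrreducibleCharacter γ) :
    ∑ g, β g * γ g⁻¹ = if β = γ then (Nat.card G : ℂ) else 0 := by
  obtain ⟨W, _, _, _, σ, hσ, rfl⟩ := hβ
  obtain ⟨U, _, _, _, τ, hτ, rfl⟩ := hγ
  have hcard : (Nat.card G : ℂ) ≠ 0 := Nat.cast_ne_zero.mpr Nat.card_pos.ne'
  let _ : Invertible (Nat.card G : ℂ) := invertibleOfNonzero hcard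
  have h := Representation.char_orthonormal σ τ
  rw [inv_mul_eq_iff_eq_mul₀ hcard] at h
  rw [h]
  split_ifs with h₁ h₂ h₂
  · simp
  · exact absurd (Representation.char_iso h₁.some).symm h₂
  · have h' := Representation.char_orthonormal σ σ
    rw [if_pos ⟨Representation.Equiv.refl σ⟩, inv_mul_eq_iff_eq_mul₀ hcard] at h'
    rw [if_neg h₁, ← h₂] at h
    exact (h.symm.trans h').trans (mul_one _)
  · simp

open scoped Classical in
theorem mul_sum_inv_mul (hβ : IsIrreducibleCharacter β) (hγ : IsIrreducibleCharacter γ) (y : G) :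
    β 1 * ∑ x, γ x⁻¹ * β (x * y) = if β = γ then (Nat.card G : ℂ) * β y else 0 := by
  have horth := hβ.sum_mul_inv hγ
  obtain ⟨W, _, _, _, σ, hσ, rfl⟩ := hβ
  obtain ⟨U, _, _, _, τ, hτ, rfl⟩ := hγ
  obtain ⟨c, hc, hct⟩ := σ.exists_eq_smul_one_of_commute
    (∑ x, τ.character x⁻¹ • σ x) (fun g ↦ by
      rw [Finset.sum_mul, Finset.mul_sum]
      refine Fintype.sum_equiv (MulAut.conj g⁻¹).toEquiv _ _ fun x ↦ ?_
      have h1 : τ.character ((MulAut.conj g⁻¹) x)⁻¹ = τ.character x⁻¹ := by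
        rw [← map_inv, MulAut.conj_apply, Representation.char_conj]
      simp only [MulEquiv.toEquiv_eq_coe, EquivLike.coe_coe]
      rw [h1, smul_mul_assoc, mul_smul_comm, ← map_mul, ← map_mul]
      simp [mul_assoc])
  have hsum : ∑ x, τ.character x⁻¹ * σ.character (x * y) = c * σ.character y := by
    have := congrArg (fun f ↦ LinearMap.trace ℂ W (f * σ y)) hc
    simpa [Finset.sum_mul, Representation.character] using this
  have htr : LinearMap.trace ℂ W (∑ x, τ.character x⁻¹ • σ x)
      = ∑ x, σ.character x * τ.character x⁻¹ := by
    simp [Representation.character, mul_comm]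
  rw [hsum, ← mul_assoc, σ.char_one, hct, htr, horth, ite_mul, zero_mul]

theorem exists_isIntegral_mul_sum_conj (hβ : IsIrreducibleCharacter β) (y : G) :
    ∃ c : ℂ, IsIntegral ℤ c ∧ β 1 * c = Nat.card G * β y ∧
      ∀ x, ∑ g, β (x * (g * y * g⁻¹)) = c * β x := by
  obtain ⟨W, _, _, _, σ, hσ, rfl⟩ := hβ
  obtain ⟨c, hc, hct⟩ := σ.exists_eq_smul_one_of_commute
    (∑ g, σ (g * y * g⁻¹)) (fun h ↦ by
      rw [Finset.sum_mul, Finset.mul_sum]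
      refine Fintype.sum_equiv (Equiv.mulLeft h⁻¹) _ _ fun g ↦ ?_
      simp only [← map_mul, Equiv.coe_mulLeft]
      congr 1
      group)
  refine ⟨c, ?_, ?_, fun x ↦ ?_⟩
  · have : Nontrivial W := σ.nontrivial_of_isIrreducible
    let F : MonoidAlgebra ℤ G →ₐ[ℤ] Module.End ℂ W := MonoidAlgebra.lift ℤ _ G σ
    have hF : F (∑ g, MonoidAlgebra.of ℤ G (g * y * g⁻¹)) = algebraMap ℂ (Module.End ℂ W) c := by
      rw [map_sum, Algebra.algebraMap_eq_smul_one, ← hc]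
      exact Finset.sum_congr rfl fun g _ ↦ MonoidAlgebra.lift_of _ _
    have : Module.Finite ℤ (MonoidAlgebra ℤ G) := inferInstance
    have hintegral := (Algebra.IsIntegral.isIntegral (R := ℤ)
      (∑ g, MonoidAlgebra.of ℤ G (g * y * g⁻¹))).map F
    rw [hF] at hintegral
    exact (isIntegral_algebraMap_iff (FaithfulSMul.algebraMap_injective ℂ _)).mp hintegral
  · rw [σ.char_one, hct, map_sum]
    change ∑ g, σ.character (g * y * g⁻¹) = _
    simp [Representation.char_conj]
  · have := congrArg (fun f ↦ LinearMap.trace ℂ W (σ x * f)) hc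
    simpa [Finset.mul_sum, Representation.character] using this

theorem one_mul_sum_mul_conj (hβ : IsIrreducibleCharacter β) (x y : G) :
    β 1 * ∑ g, β (x * (g * y * g⁻¹)) = Nat.card G * β x * β y := by
  obtain ⟨c, -, hc, hsum⟩ := hβ.exists_isIntegral_mul_sum_conj y
  rw [hsum, ← mul_assoc, hc]
  ring

theorem one_dvd_card_sq (hβ : IsIrreducibleCharacter β) {d : ℕ} (hd : β 1 = d) :
    d ∣ Nat.card G ^ 2 := by
  choose c hc hcβ _ using hβ.exists_isIntegral_mul_sum_conj
  have horth := hβ.sum_mul_inv hβ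
  rw [if_pos rfl] at horth
  have key : ((Nat.card G ^ 2 : ℕ) : ℤ) = ((d : ℤ) : ℂ) * ∑ y, c y * β y⁻¹ := by
    rw [Finset.mul_sum]
    simp_rw [← mul_assoc, Int.cast_natCast, ← hd, hcβ, mul_assoc, ← Finset.mul_sum]
    rw [horth]
    push_cast
    ring
  exact Int.natCast_dvd_natCast.mp (Int.dvd_of_eq_mul_isIntegral key
    (IsIntegral.sum _ fun y _ ↦ (hc y).mul (hβ.isIntegral _)))

end IsIrreducibleCharacter

variable [Fintype G] {s : Multiset (G → ℂ)} {β : G → ℂ}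

open scoped Classical in
theorem Multiset.sum_apply_mul_inv (hs : ∀ γ ∈ s, IsIrreducibleCharacter γ)
    (hβ : IsIrreducibleCharacter β) :
    ∑ x, s.sum x * β x⁻¹ = Nat.card G * s.count β := by
  induction s using Multiset.induction_on with
  | empty => simp
  | cons γ s ih =>
    simp only [Multiset.mem_cons, forall_eq_or_imp] at hs
    simp only [Multiset.sum_cons, Pi.add_apply, add_mul, Finset.sum_add_distrib, ih hs.2,
      hs.1.sum_mul_inv hβ, Multiset.count_cons, eq_comm (a := γ)]
    split_ifs <;> push_cast <;> ring

open scoped Classical in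
theorem Multiset.mul_sum_inv_mul_apply (hs : ∀ γ ∈ s, IsIrreducibleCharacter γ)
    (hβ : IsIrreducibleCharacter β) (y : G) :
    β 1 * ∑ x, β x⁻¹ * s.sum (x * y) = Nat.card G * s.count β * β y := by
  induction s using Multiset.induction_on with
  | empty => simp
  | cons γ s ih =>
    simp only [Multiset.mem_cons, forall_eq_or_imp] at hs
    have hγ : β 1 * ∑ x, β x⁻¹ * γ (x * y) = if β = γ then (Nat.card G : ℂ) * β y else 0 := by
      rcases eq_or_ne β γ with rfl | hne
      · exact hβ.mul_sum_inv_mul hβ y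
      · have h := hs.1.mul_sum_inv_mul hβ y
        rw [if_neg hne.symm] at h
        obtain ⟨d, hd, hd'⟩ := hs.1.exists_natCast_eq_one
        have h1 : γ 1 ≠ 0 := by rw [hd']; exact_mod_cast hd.ne'
        rw [(mul_eq_zero.mp h).resolve_left h1, if_neg hne, mul_zero]
    simp only [Multiset.sum_cons, Pi.add_apply, mul_add, Finset.sum_add_distrib, ih hs.2,
      hγ, Multiset.count_cons]
    split_ifs <;> push_cast <;> ring

open scoped Classical in
theorem Multiset.sum_apply_mul_sum_inv (hs : ∀ γ ∈ s, IsIrreducibleCharacter γ) :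
    ∑ x, s.sum x * s.sum x⁻¹ = Nat.card G * ((s.map fun γ ↦ s.count γ).sum : ℕ) := by
  have key : ∀ t : Multiset (G → ℂ), (∀ γ ∈ t, IsIrreducibleCharacter γ) →
      ∑ x, s.sum x * t.sum x⁻¹ = Nat.card G * ((t.map fun γ ↦ s.count γ).sum : ℕ) := by
    intro t
    induction t using Multiset.induction_on with
    | empty => simp
    | cons γ t ih =>
      intro ht
      simp only [Multiset.mem_cons, forall_eq_or_imp] at ht
      simp only [Multiset.sum_cons, Pi.add_apply, mul_add, Finset.sum_add_distrib, ih ht.2,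
        Multiset.sum_apply_mul_inv hs ht.1, Multiset.map_cons, Nat.cast_add]
  exact key s hs

theorem Representation.isIrreducibleCharacter_of_sum_eq_card {V : Type} [AddCommGroup V]
    [Module ℂ V] [FiniteDimensional ℂ V] (ρ : Representation ℂ G V)
    (h : ∑ g, ρ.character g * ρ.character g⁻¹ = Nat.card G) :
    IsIrreducibleCharacter ρ.character := by
  classical
  obtain ⟨s, hs, hsum⟩ := ρ.exists_multiset_sum_eq_character
  have hcard : (Nat.card G : ℂ) ≠ 0 := Nat.cast_ne_zero.mpr Nat.card_pos.ne'
  have h1 : (s.map fun γ ↦ s.count γ).sum = 1 := by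
    rw [← hsum, Multiset.sum_apply_mul_sum_inv hs, mul_eq_left₀ hcard] at h
    exact_mod_cast h
  have hle : Multiset.card s ≤ 1 := by
    have := Multiset.card_nsmul_le_sum (s := s.map fun γ ↦ s.count γ) (a := 1)
      (by simp [Multiset.one_le_count_iff_mem])
    simpa [h1] using this
  have hne : s ≠ 0 := by rintro rfl; simp at h1
  obtain ⟨β, rfl⟩ := Multiset.card_eq_one.mp
    (le_antisymm hle (Multiset.card_pos.mpr hne))
  rw [Multiset.sum_singleton] at hsum
  exact hsum ▸ hs β (Multiset.mem_singleton_self β)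

end Characters

theorem MulAction.exists_isIntegral_sum_eq_sum_fixedPoints_add {A X : Type*} [Group A] [Fintype A]
    [Fintype X] [MulAction A X] [DecidablePred (· ∈ MulAction.fixedPoints A X)]
    (hA : (Fintype.card A).Prime) (F : X → ℂ)
    (hintegral : ∀ x, IsIntegral ℤ (F x)) (hF : ∀ (a : A) x, F (a • x) = F x) :
    ∃ z : ℂ, IsIntegral ℤ z ∧
      ∑ x, F x = ∑ x with x ∈ MulAction.fixedPoints A X, F x + Fintype.card A * z := by
  classical
  suffices h : ∃ z : ℂ, IsIntegral ℤ z ∧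
      ∑ x with x ∉ MulAction.fixedPoints A X, F x = Fintype.card A * z by
    obtain ⟨z, hz, h⟩ := h
    exact ⟨z, hz, by rw [← h, Finset.sum_filter_add_sum_filter_not]⟩
  have horb : ∀ ω : MulAction.orbitRel.Quotient A X, ∃ z : ℂ, IsIntegral ℤ z ∧
      ∑ x with x ∉ MulAction.fixedPoints A X ∧ Quotient.mk'' x = ω, F x =
        Fintype.card A * z := by
    intro ω
    by_cases hω : ∃ x, x ∉ MulAction.fixedPoints A X ∧ Quotient.mk'' x = ω
    · obtain ⟨x, hx, rfl⟩ := hω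
      refine ⟨F x, hintegral x, ?_⟩
      have hset : (Finset.univ.filter fun y : X ↦ y ∉ MulAction.fixedPoints A X ∧
          (Quotient.mk'' y : MulAction.orbitRel.Quotient A X) = Quotient.mk'' x) =
          (MulAction.orbit A x).toFinset := by
        ext y
        simp only [Finset.mem_filter, Finset.mem_univ, true_and, Set.mem_toFinset]
        rw [Quotient.eq'', MulAction.orbitRel_apply]
        refine ⟨fun h ↦ h.2, fun h ↦ ⟨fun hy ↦ hx ?_, h⟩⟩
        obtain ⟨a, rfl⟩ := MulAction.orbit_eq_iff.mpr h ▸ MulAction.mem_orbit_self x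
        change a • y ∈ _
        rwa [hy a]
      have hcard : (MulAction.orbit A x).toFinset.card = Fintype.card A := by
        rw [Set.toFinset_card]
        refine ((Nat.dvd_prime hA).mp ⟨_, (MulAction.card_orbit_mul_card_stabilizer_eq_card_group
          A x).symm⟩).resolve_left fun h1 ↦ hx ?_
        exact MulAction.mem_fixedPoints_iff_card_orbit_eq_one.mpr h1
      rw [hset, Finset.sum_congr rfl (g := fun _ ↦ F x), Finset.sum_const, hcard, nsmul_eq_mul]
      intro y hy
      obtain ⟨a, rfl⟩ := Set.mem_toFinset.mp hy
      exact hF a x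
    · refine ⟨0, isIntegral_zero, ?_⟩
      push Not at hω
      rw [mul_zero, Finset.filter_false_of_mem, Finset.sum_empty]
      rintro x - ⟨hx, hxω⟩
      exact hω x hx hxω
  choose z hz hsum using horb
  refine ⟨∑ ω, z ω, IsIntegral.sum _ fun ω _ ↦ hz ω, ?_⟩
  rw [Finset.mul_sum, ← Finset.sum_fiberwise _
    (fun x ↦ (Quotient.mk'' x : MulAction.orbitRel.Quotient A X))]
  simp_rw [Finset.filter_filter, hsum]

theorem FixedPoints.card_modEq_card_subgroup {A G : Type*} [Group A] [Fintype A] [Group G]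
    [Finite G] [MulDistribMulAction A G] (hA : (Fintype.card A).Prime) :
    Nat.card G ≡ Nat.card (FixedPoints.subgroup A G) [MOD Fintype.card A] := by
  have : Fact (Fintype.card A).Prime := ⟨hA⟩
  have hpA : IsPGroup (Fintype.card A) A := IsPGroup.of_card (n := 1) (by simp)
  exact hpA.card_modEq_card_fixedPoints G

section FixedPoints

variable {A G : Type*} [Group A] [Fintype A] [Group G] [Fintype G] [MulDistribMulAction A G]
  [Fintype (FixedPoints.subgroup A G)]

theorem FixedPoints.exists_isIntegral_sum_eq_sum_subgroup_add
    (hA : (Fintype.card A).Prime) (F : G → ℂ)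
    (hintegral : ∀ x, IsIntegral ℤ (F x)) (hF : ∀ (a : A) x, F (a • x) = F x) :
    ∃ z : ℂ, IsIntegral ℤ z ∧
      ∑ x, F x = ∑ c : FixedPoints.subgroup A G, F c + Fintype.card A * z := by
  classical
  obtain ⟨z, hz, h⟩ := MulAction.exists_isIntegral_sum_eq_sum_fixedPoints_add hA F hintegral hF
  refine ⟨z, hz, ?_⟩
  rw [h, Finset.sum_subtype (p := (· ∈ FixedPoints.subgroup A G)) _ (fun x ↦ by simp)]

variable {χ : G → ℂ} {s : Multiset (FixedPoints.subgroup A G → ℂ)}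

open scoped Classical in
theorem IsIrreducibleCharacter.dvd_card_sub_card_mul_sum_count (hA : (Fintype.card A).Prime)
    (hχ : IsIrreducibleCharacter χ) (hinv : ∀ (a : A) g, χ (a • g) = χ g)
    (hs : ∀ β ∈ s, IsIrreducibleCharacter β) (hsum : ∀ c, s.sum c = χ c) :
    (Fintype.card A : ℤ) ∣ Nat.card G -
      Nat.card (FixedPoints.subgroup A G) * ((s.map fun γ ↦ s.count γ).sum : ℕ) := by
  obtain ⟨z, hz, h⟩ := FixedPoints.exists_isIntegral_sum_eq_sum_subgroup_add hA
    (fun g ↦ χ g * χ g⁻¹) (fun g ↦ (hχ.isIntegral g).mul (hχ.isIntegral _))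
    (fun a g ↦ by rw [← smul_inv', hinv, hinv])
  refine Int.dvd_of_eq_mul_isIntegral ?_ hz
  have hC := Multiset.sum_apply_mul_sum_inv hs
  simp only [hsum, Subgroup.coe_inv] at hC
  rw [hC, hχ.sum_mul_inv hχ, if_pos rfl] at h
  simp only [Int.cast_sub, Int.cast_mul, Int.cast_natCast]
  linear_combination h

open scoped Classical in
theorem IsIrreducibleCharacter.dvd_mul_count_mul_count_sub (hA : (Fintype.card A).Prime)
    (hχ : IsIrreducibleCharacter χ) (hinv : ∀ (a : A) g, χ (a • g) = χ g)
    (hs : ∀ β ∈ s, IsIrreducibleCharacter β) (hsum : ∀ c, s.sum c = χ c)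
    {β γ : FixedPoints.subgroup A G → ℂ} (hβ : IsIrreducibleCharacter β)
    (hγ : IsIrreducibleCharacter γ) {d D : ℕ} (hd : β 1 = d) (hD : χ 1 = D) :
    (Fintype.card A : ℤ) ∣
      d * Nat.card G * Nat.card (FixedPoints.subgroup A G) ^ 2 * s.count β * s.count γ -
        D * Nat.card (FixedPoints.subgroup A G) ^ 3 * s.count β * if β = γ then 1 else 0 := by
  let F : G → ℂ := fun g ↦
    ∑ x : FixedPoints.subgroup A G, ∑ y : FixedPoints.subgroup A G,
      β x⁻¹ * γ y⁻¹ * χ (x * (g * y * g⁻¹))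
  obtain ⟨z, hz, h⟩ := FixedPoints.exists_isIntegral_sum_eq_sum_subgroup_add hA F
    (fun g ↦ IsIntegral.sum _ fun x _ ↦ IsIntegral.sum _ fun y _ ↦
      ((hβ.isIntegral _).mul (hγ.isIntegral _)).mul (hχ.isIntegral _))
    (fun a g ↦ by
      refine Finset.sum_congr rfl fun x _ ↦ Finset.sum_congr rfl fun y _ ↦ ?_
      congr 1
      rw [← hinv a ((x : G) * (g * y * g⁻¹))]
      simp only [smul_mul', smul_inv']
      rw [show a • (x : G) = x from x.2 a, show a • (y : G) = y from y.2 a])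
  have hG : χ 1 * ∑ g, F g =
      Nat.card G * (Nat.card (FixedPoints.subgroup A G) * s.count β) *
        (Nat.card (FixedPoints.subgroup A G) * s.count γ) := by
    calc χ 1 * ∑ g, F g
        = ∑ x : FixedPoints.subgroup A G, ∑ y : FixedPoints.subgroup A G,
            β x⁻¹ * γ y⁻¹ * (χ 1 * ∑ g, χ (x * (g * y * g⁻¹))) := by
          simp only [F, Finset.mul_sum]
          rw [Finset.sum_comm]
          refine Finset.sum_congr rfl fun x _ ↦ ?_
          rw [Finset.sum_comm]
          refine Finset.sum_congr rfl fun y _ ↦ Finset.sum_congr rfl fun g _ ↦ ?_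
          ring
      _ = Nat.card G * (∑ x : FixedPoints.subgroup A G, s.sum x * β x⁻¹) *
            (∑ y : FixedPoints.subgroup A G, s.sum y * γ y⁻¹) := by
          simp only [hχ.one_mul_sum_mul_conj, hsum, mul_assoc (Nat.card G : ℂ), Finset.sum_mul_sum]
          simp only [Finset.mul_sum]
          refine Finset.sum_congr rfl fun x _ ↦ Finset.sum_congr rfl fun y _ ↦ ?_
          ring
      _ = _ := by rw [Multiset.sum_apply_mul_inv hs hβ, Multiset.sum_apply_mul_inv hs hγ]
  have hFc : ∀ c : FixedPoints.subgroup A G, F c =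
      ∑ y : FixedPoints.subgroup A G, γ y⁻¹ * ∑ x : FixedPoints.subgroup A G, β x⁻¹ * s.sum (x * y) := by
    intro c
    simp only [F, Finset.mul_sum]
    rw [Finset.sum_comm]
    refine Fintype.sum_equiv (MulAut.conj c).toEquiv _ _ fun y ↦ Finset.sum_congr rfl fun x _ ↦ ?_
    have hγc : γ ((MulAut.conj c) y)⁻¹ = γ y⁻¹ := by
      obtain ⟨W, _, _, _, σ, -, rfl⟩ := hγ
      rw [← map_inv, MulAut.conj_apply, Representation.char_conj]
    simp only [MulEquiv.toEquiv_eq_coe, EquivLike.coe_coe]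
    rw [hγc, hsum]
    simp only [MulAut.conj_apply, Subgroup.coe_mul, Subgroup.coe_inv]
    ring
  have hC : β 1 * ∑ c : FixedPoints.subgroup A G, F c =
      Nat.card (FixedPoints.subgroup A G) ^ 3 * s.count β * if β = γ then 1 else 0 := by
    calc β 1 * ∑ c : FixedPoints.subgroup A G, F c
        = Nat.card (FixedPoints.subgroup A G) * ∑ y : FixedPoints.subgroup A G,
            γ y⁻¹ * (β 1 * ∑ x : FixedPoints.subgroup A G, β x⁻¹ * s.sum (x * y)) := by
          simp only [hFc, Finset.sum_const, Finset.card_univ, nsmul_eq_mul,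
            Nat.card_eq_fintype_card, Finset.mul_sum]
          refine Finset.sum_congr rfl fun y _ ↦ Finset.sum_congr rfl fun x _ ↦ ?_
          ring
      _ = Nat.card (FixedPoints.subgroup A G) *
            (Nat.card (FixedPoints.subgroup A G) * s.count β *
              ∑ y : FixedPoints.subgroup A G, β y * γ y⁻¹) := by
          simp only [Multiset.mul_sum_inv_mul_apply hs hβ]
          simp only [Finset.mul_sum]
          refine Finset.sum_congr rfl fun y _ ↦ ?_
          ring
      _ = _ := by
          rw [hβ.sum_mul_inv hγ]
          split_ifs <;> ring
  refine Int.dvd_of_eq_mul_isIntegral (z := d * D * z) ?_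
    (((isIntegral_natCast d).mul (isIntegral_natCast D)).mul hz)
  push_cast
  rw [hd] at hC
  rw [hD] at hG
  linear_combination (-(d : ℂ)) * hG + (D : ℂ) * hC + (d : ℂ) * D * h

/-- The degree congruence of the Glauberman correspondence: if a group `A` of prime order not
dividing `|G|` fixes an irreducible character `χ` of `G`, then some irreducible constituent of
the restriction of `χ` to the fixed points of `A` has degree congruent to `± χ 1` modulo `|A|`. -/
theorem IsIrreducibleCharacter.exists_mem_sq_eq_sq {p : ℕ} [Fact p.Prime]
    (hA : Fintype.card A = p) (hpG : (Nat.card G : ZMod p) ≠ 0)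
    (hχ : IsIrreducibleCharacter χ) (hinv : ∀ (a : A) g, χ (a • g) = χ g)
    (hs : ∀ β ∈ s, IsIrreducibleCharacter β) (hsum : ∀ c, s.sum c = χ c) {D : ℕ} (hD : χ 1 = D) :
    ∃ β ∈ s, ∃ d : ℕ, β 1 = d ∧ (d : ZMod p) ^ 2 = (D : ZMod p) ^ 2 := by
  classical
  have hp : (Fintype.card A).Prime := hA ▸ Fact.out
  have hcard : (Nat.card (FixedPoints.subgroup A G) : ZMod p) = Nat.card G := by
    rw [ZMod.natCast_eq_natCast_iff, ← hA]
    exact (FixedPoints.card_modEq_card_subgroup hp).symm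
  have hM : (s.map fun γ ↦ (s.count γ : ZMod p)).sum = 1 := by
    have h := hχ.dvd_card_sub_card_mul_sum_count hp hinv hs hsum
    rw [hA, ← ZMod.intCast_zmod_eq_zero_iff_dvd] at h
    simp only [Int.cast_sub, Int.cast_mul, Int.cast_natCast, hcard] at h
    rw [sub_eq_zero, eq_comm, mul_eq_left₀ hpG, Nat.cast_multiset_sum, Multiset.map_map] at h
    exact h
  have hmul : ∀ β ∈ s, ∀ γ ∈ s, ∀ d : ℕ, β 1 = d →
      (d : ZMod p) * s.count β * s.count γ = D * s.count β * if β = γ then 1 else 0 := by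
    intro β hβ γ hγ d hd
    have h := hχ.dvd_mul_count_mul_count_sub hp hinv hs hsum (hs β hβ) (hs γ hγ) hd hD
    rw [hA, ← ZMod.intCast_zmod_eq_zero_iff_dvd] at h
    push_cast at h
    rw [hcard] at h
    refine mul_left_cancel₀ (pow_ne_zero 3 hpG) ?_
    linear_combination h
  obtain ⟨β, hβ, hβ0⟩ : ∃ β ∈ s, (s.count β : ZMod p) ≠ 0 := by
    by_contra! h
    rw [Multiset.map_congr rfl h] at hM
    simp at hM
  obtain ⟨d, -, hd⟩ := (hs β hβ).exists_natCast_eq_one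
  have hd0 : (d : ZMod p) ≠ 0 := by
    intro h0
    have h1 : ((Nat.card (FixedPoints.subgroup A G) ^ 2 : ℕ) : ZMod p) = 0 := by
      rw [ZMod.natCast_eq_zero_iff] at h0 ⊢
      exact h0.trans ((hs β hβ).one_dvd_card_sq hd)
    rw [Nat.cast_pow, hcard] at h1
    exact hpG (pow_eq_zero_iff two_ne_zero |>.mp h1)
  have hself : (d : ZMod p) * s.count β = D := by
    have h := hmul β hβ β hβ d hd
    rw [if_pos rfl, mul_one] at h
    exact mul_right_cancel₀ hβ0 h
  have hsq : (s.count β : ZMod p) ^ 2 = 1 := by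
    rw [← hM, Finset.sum_multiset_map_count, Finset.sum_eq_single β]
    · rw [nsmul_eq_mul, sq]
    · intro γ hγ hne
      have h := hmul β hβ γ (Multiset.mem_toFinset.mp hγ) d hd
      rw [if_neg hne.symm, mul_zero] at h
      rw [(mul_eq_zero.mp h).resolve_left (mul_ne_zero hd0 hβ0), smul_zero]
    · exact fun h ↦ absurd (Multiset.mem_toFinset.mpr hβ) h
  refine ⟨β, hβ, d, hd, ?_⟩
  rw [← hself, mul_pow, hsq, mul_one]

end FixedPoints

theorem Multiset.exists_natCast_eq_sum_one {G : Type*} [Group G] {s : Multiset (G → ℂ)}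
    (hs : ∀ β ∈ s, IsIrreducibleCharacter β) : ∃ e : ℕ, s.sum 1 = e ∧ (e = 0 → s = 0) := by
  induction s using Multiset.induction_on with
  | empty => exact ⟨0, by simp⟩
  | cons β s ih =>
    simp only [Multiset.mem_cons, forall_eq_or_imp] at hs
    obtain ⟨d, hd, hd'⟩ := hs.1.exists_natCast_eq_one
    obtain ⟨e, he, -⟩ := ih hs.2
    exact ⟨d + e, by simp [hd', he], fun h ↦ by omega⟩

/-- If the restriction of `ρ` to a subgroup `C` has character norm one, then an automorphism of `G`
that fixes `C` pointwise and preserves the character of `ρ` is invisible to `ρ`. -/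
theorem Representation.apply_mulAut_eq_of_sum_eq_card {G V : Type*} [Group G] [Fintype G]
    [AddCommGroup V] [Module ℂ V] [FiniteDimensional ℂ V] (ρ : Representation ℂ G V)
    (C : Subgroup G) [Fintype C]
    (hρ : ∑ g, ρ.character g * ρ.character g⁻¹ = Nat.card G)
    (hC : ∑ c : C, ρ.character c * ρ.character (c : G)⁻¹ = Nat.card C)
    (α : MulAut G) (hα : ∀ c ∈ C, α c = c) (hinv : ∀ g, ρ.character (α g) = ρ.character g)
    (g : G) : ρ (α g) = ρ g := by
  have hcardG : (Nat.card G : ℂ) ≠ 0 := Nat.cast_ne_zero.mpr Nat.card_pos.ne'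
  have hcardC : (Nat.card C : ℂ) ≠ 0 := Nat.cast_ne_zero.mpr Nat.card_pos.ne'
  let _ : Invertible (Nat.card G : ℂ) := invertibleOfNonzero hcardG
  let _ : Invertible (Nat.card C : ℂ) := invertibleOfNonzero hcardC
  let τ : Representation ℂ G V := ρ.comp α.toMonoidHom
  let ρC : Representation ℂ C V := ρ.comp C.subtype
  have hτ : Module.finrank ℂ (IntertwiningMap ρ τ) = 1 := by
    have h := card_inv_mul_sum_char_mul_char_eq_finrank ρ τ
    have hτρ : τ.character = ρ.character := funext hinv
    rw [hτρ, hρ, inv_mul_cancel₀ hcardG] at h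
    exact_mod_cast h.symm
  have hρC : Module.finrank ℂ (IntertwiningMap ρC ρC) = 1 := by
    have h := card_inv_mul_sum_char_mul_char_eq_finrank ρC ρC
    have hsum : ∑ c : C, ρC.character c * ρC.character c⁻¹ = Nat.card C := hC
    rw [hsum, inv_mul_cancel₀ hcardC] at h
    exact_mod_cast h.symm
  have hV : Nontrivial V := by
    by_contra h
    rw [not_nontrivial_iff_subsingleton] at h
    have : Subsingleton (IntertwiningMap ρC ρC) :=
      ⟨fun f f' ↦ IntertwiningMap.ext (Subsingleton.elim _ _)⟩
    rw [Module.finrank_zero_of_subsingleton] at hρC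
    exact zero_ne_one hρC
  obtain ⟨T, hT, -⟩ := finrank_eq_one_iff'.mp hτ
  have hid : IntertwiningMap.id ρC ≠ 0 := by
    obtain ⟨v, hv⟩ := exists_ne (0 : V)
    exact fun h ↦ hv (congrArg (fun f : IntertwiningMap ρC ρC ↦ f v) h)
  let TC : IntertwiningMap ρC ρC := ⟨T.toLinearMap, fun c ↦ by
    have h := T.isIntertwining' (c : G)
    have hτc : τ (c : G) = ρ c := congrArg ρ (hα c c.2)
    rw [hτc] at h
    exact h⟩
  obtain ⟨k, hk⟩ := (finrank_eq_one_iff_of_nonzero' _ hid).mp hρC TC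
  have hTk : T.toLinearMap = k • LinearMap.id := by
    exact (congrArg IntertwiningMap.toLinearMap hk).symm
  have hk0 : k ≠ 0 := by
    rintro rfl
    exact hT (IntertwiningMap.ext (by rw [hTk, zero_smul]; rfl))
  have h := T.isIntertwining' g
  rw [hTk, LinearMap.smul_comp, LinearMap.comp_smul, LinearMap.id_comp, LinearMap.comp_id] at h
  exact (smul_right_injective _ hk0 h).symm

theorem order_le_of_invariant_faithful_char
    {p r : ℕ} (hp : p.Prime) (hr : r.Prime) (hpr : p ≠ r)
    {G : Type} [Group G] [Fintype G] (hG : IsPGroup r G)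
    {A : Type} [Group A] [Fintype A] (hA : Fintype.card A = p)
    (φ : A →* MulAut G) (hfaith : Function.Injective φ)
    (V : FDRep ℂ G) [Simple V] (hVfaith : Function.Injective V.ρ)
    (hinv : ∀ (b : A) (g : G), V.character (φ b g) = V.character g)
    (a : ℕ) (hdim : Module.finrank ℂ V = r ^ a) :
    orderOf ((r : ZMod p)) ≤ 2 * a := by
  classical
  have : Fact p.Prime := ⟨hp⟩
  have : Fact r.Prime := ⟨hr⟩
  let _ : MulDistribMulAction A G := MulDistribMulAction.compHom G φ
  have hr0 : (r : ZMod p) ≠ 0 := by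
    rw [Ne, ZMod.natCast_eq_zero_iff]
    exact fun h ↦ hpr ((Nat.prime_dvd_prime_iff_eq hp hr).mp h)
  have hnorm := (FDRep.simple_iff_char_is_norm_one V).mp inferInstance
  have hχ : IsIrreducibleCharacter V.character :=
    Representation.isIrreducibleCharacter_of_sum_eq_card V.ρ hnorm
  obtain ⟨s, hs, hsum⟩ :=
    Representation.exists_multiset_sum_eq_character (V.ρ.comp (FixedPoints.subgroup A G).subtype)
  have hsum' : ∀ c, s.sum c = V.character c := fun c ↦ by rw [hsum]; rfl
  have hD : V.character 1 = (r ^ a : ℕ) := by rw [FDRep.char_one, hdim]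
  have hpG : (Nat.card G : ZMod p) ≠ 0 := by
    obtain ⟨n, hn⟩ := IsPGroup.iff_card.mp hG
    rw [hn, Nat.cast_pow]
    exact pow_ne_zero n hr0
  obtain ⟨β, hβ, d, hd, hsq⟩ := hχ.exists_mem_sq_eq_sq hA hpG hinv hs hsum' hD
  obtain ⟨b, rfl⟩ : ∃ b, d = r ^ b := by
    obtain ⟨n, hn⟩ := IsPGroup.iff_card.mp (hG.to_subgroup (FixedPoints.subgroup A G))
    have h := (hs β hβ).one_dvd_card_sq hd
    rw [hn, ← pow_mul] at h
    obtain ⟨b, -, hb⟩ := (Nat.dvd_prime_pow hr).mp h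
    exact ⟨b, hb⟩
  obtain ⟨t, rfl⟩ := Multiset.exists_cons_of_mem hβ
  obtain ⟨e, he, he0⟩ := Multiset.exists_natCast_eq_sum_one
    fun γ hγ ↦ hs γ (Multiset.mem_cons_of_mem hγ)
  have hdeg : r ^ b + e = r ^ a := by
    have h := hsum' 1
    rw [Multiset.sum_cons, Pi.add_apply, hd, he, OneMemClass.coe_one, hD] at h
    exact_mod_cast h
  have hba : b ≤ a := (Nat.pow_le_pow_iff_right hr.one_lt).mp (by omega)
  rcases hba.lt_or_eq with hlt | rfl
  · have hpow : (r : ZMod p) ^ (2 * (a - b)) = 1 := by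
      refine mul_left_cancel₀ (pow_ne_zero (2 * b) hr0) ?_
      rw [← pow_add, mul_one, show 2 * b + 2 * (a - b) = a * 2 by omega, mul_comm 2 b, pow_mul,
        pow_mul]
      exact_mod_cast hsq.symm
    exact (orderOf_le_of_pow_eq_one (by omega) hpow).trans (by omega)
  · exfalso
    obtain rfl := he0 (by omega)
    have hCnorm : ∑ c : FixedPoints.subgroup A G, V.character c * V.character (c : G)⁻¹ =
        Nat.card (FixedPoints.subgroup A G) := by
      have h := (hs β hβ).sum_mul_inv (hs β hβ)
      rw [if_pos rfl] at h
      rw [← h]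
      simp only [← Subgroup.coe_inv, ← hsum', Multiset.cons_zero, Multiset.sum_singleton]
    have htriv : ∀ x : A, x = 1 := by
      intro x
      refine hfaith (MulEquiv.ext fun g ↦ hVfaith ?_)
      rw [map_one]
      exact Representation.apply_mulAut_eq_of_sum_eq_card V.ρ (FixedPoints.subgroup A G) hnorm
        hCnorm (φ x) (fun c hc ↦ hc x) (hinv x) g
    exact hp.one_lt.ne' (hA ▸ Fintype.card_eq_one_iff.mpr ⟨1, htriv⟩)
end
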